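/- arXiv:1112.2326 — 13 statements merged into one kernel-verified Lean document; each statement's English description precedes it below -/
import Mathlib

section
/- Every finite simple connected graph G has a minimum dominating set Γ (i.e., a dominating set whose cardinality equals the domination number γ(G)) that contains no pair of false twin vertices, i.e., there are no two distinct vertices u, v ∈ Γ with N(u) = N(v). -/
open SimpleGraph Finset

variable {V : Type*}

/-- `Γ` is a dominating set for `G`: every vertex not in `Γ` has a neighbor in `Γ`. -/
def IsDominatingSet (G : SimpleGraph V) (Γ : Finset V) : Prop :=
  ∀ v : V, v ∉ Γ → ∃ u ∈ Γ, G.Adj v u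

/-- The domination number `γ(G)`: the minimum cardinality of a dominating set. -/
noncomputable def dominationNumber (G : SimpleGraph V) [Fintype V] : ℕ :=
  sInf {k | ∃ Γ : Finset V, IsDominatingSet G Γ ∧ Γ.card = k}

/-- `W` is a resolving set for `G`: any two distinct vertices are distinguished by their
distance to some vertex of `W`. -/
def IsResolvingSet (G : SimpleGraph V) (W : Finset V) : Prop :=
  ∀ u v : V, u ≠ v → ∃ w ∈ W, G.dist u w ≠ G.dist v w

/-- The metric dimension `β(G)`: the minimum cardinality of a resolving set. -/
noncomputable def metricDimension (G : SimpleGraph V) [Fintype V] : ℕ :=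
  sInf {k | ∃ W : Finset V, IsResolvingSet G W ∧ W.card = k}

/-- Every finite simple connected graph has a minimum dominating set
containing no pair of false twin vertices (distinct vertices with equal neighborhoods). -/
theorem exists_minimum_dominating_set_no_false_twins [Fintype V]
    (G : SimpleGraph V) (hG : G.Connected) :
    ∃ Γ : Finset V, IsDominatingSet G Γ ∧ Γ.card = dominationNumber G ∧
      ∀ u ∈ Γ, ∀ v ∈ Γ, u ≠ v → G.neighborSet u ≠ G.neighborSet v := by
  classical
  -- minimum dominating sets exist
  have hne : {k | ∃ Γ : Finset V, IsDominatingSet G Γ ∧ Γ.card = k}.Nonempty :=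
    ⟨_, Finset.univ, fun v hv => absurd (Finset.mem_univ v) hv, rfl⟩
  obtain ⟨Γ₀, hΓ₀, hc₀⟩ := Nat.sInf_mem hne
  have hmin : ∀ Δ : Finset V, IsDominatingSet G Δ → dominationNumber G ≤ Δ.card :=
    fun Δ hΔ => Nat.sInf_le ⟨Δ, hΔ, rfl⟩
  -- among them, maximize the number of vertices that are not isolated inside the set
  let S : Finset V → Finset V := fun Γ => Γ.filter (fun x => ∃ y ∈ Γ, G.Adj x y)
  obtain ⟨Γ, hΓ, hmax⟩ := Finset.exists_max_image
    (Finset.univ.filter (fun Γ : Finset V =>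
      IsDominatingSet G Γ ∧ Γ.card = dominationNumber G))
    (fun Γ => (S Γ).card) ⟨Γ₀, by simpa using ⟨hΓ₀, hc₀⟩⟩
  simp only [Finset.mem_filter, Finset.mem_univ, true_and] at hΓ hmax
  obtain ⟨hdom, hcard⟩ := hΓ
  refine ⟨Γ, hdom, hcard, ?_⟩
  intro u hu v hv huv hN
  have hadj : ∀ x, G.Adj x u ↔ G.Adj x v := fun x => by
    have := Set.ext_iff.mp hN x
    simpa [SimpleGraph.mem_neighborSet, G.adj_comm] using this
  -- `u` has no neighbor in `Γ`, otherwise `u` could be removed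
  have hiso : ∀ w ∈ Γ, ¬ G.Adj u w := by
    intro w hw huw
    have hd : IsDominatingSet G (Γ.erase u) := by
      intro x hx
      by_cases hxu : x = u
      · subst hxu
        exact ⟨w, Finset.mem_erase.mpr ⟨huw.ne', hw⟩, huw⟩
      · obtain ⟨y, hy, hxy⟩ := hdom x (fun h => hx (Finset.mem_erase.mpr ⟨hxu, h⟩))
        by_cases hyu : y = u
        · subst hyu
          exact ⟨v, Finset.mem_erase.mpr ⟨huv.symm, hv⟩, (hadj x).mp hxy⟩
        · exact ⟨y, Finset.mem_erase.mpr ⟨hyu, hy⟩, hxy⟩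
    have h1 := hmin _ hd
    have h2 := Finset.card_erase_lt_of_mem hu
    omega
  haveI : Nontrivial V := ⟨u, v, huv⟩
  obtain ⟨w, huw⟩ := hG.preconnected.exists_adj_of_nontrivial u
  have hwΓ : w ∉ Γ := fun h => hiso w h huw
  have hwv : G.Adj w v := (hadj w).mp huw.symm
  -- exchange `u` for `w`
  have hd : IsDominatingSet G (insert w (Γ.erase u)) := by
    intro x hx
    simp only [Finset.mem_insert, Finset.mem_erase, not_or, not_and] at hx
    by_cases hxu : x = u
    · subst hxu
      exact ⟨w, Finset.mem_insert_self _ _, huw⟩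
    · obtain ⟨y, hy, hxy⟩ := hdom x (hx.2 hxu)
      by_cases hyu : y = u
      · subst hyu
        exact ⟨v, by simp [huv.symm, hv], (hadj x).mp hxy⟩
      · exact ⟨y, by simp [hyu, hy], hxy⟩
  have hc : (insert w (Γ.erase u)).card = dominationNumber G := by
    rw [Finset.card_insert_of_notMem (by simp [hwΓ]), Finset.card_erase_add_one hu, hcard]
  have hlt : (S Γ).card < (S (insert w (Γ.erase u))).card := by
    apply Finset.card_lt_card
    rw [Finset.ssubset_iff_of_subset]
    · refine ⟨v, ?_, ?_⟩
      · simp only [S, Finset.mem_filter]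
        exact ⟨by simp [huv.symm, hv], w, Finset.mem_insert_self _ _, hwv.symm⟩
      · simp only [S, Finset.mem_filter, not_and]
        rintro - ⟨y, hy, hvy⟩
        exact hiso y hy ((hadj y).mpr hvy.symm).symm
    · intro x hx
      simp only [S, Finset.mem_filter] at hx ⊢
      obtain ⟨hxΓ, y, hy, hxy⟩ := hx
      have hxu : x ≠ u := by
        rintro rfl
        exact hiso y hy hxy
      have hyu : y ≠ u := by
        rintro rfl
        exact hiso x hxΓ hxy.symm
      exact ⟨by simp [hxu, hxΓ], y, by simp [hyu, hy], hxy⟩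
  exact absurd (hmax _ ⟨hd, hc⟩) (not_le.mpr hlt)
end

section
/- Let G be a finite simple connected graph and let Γ be a minimum dominating set for G (|Γ| = γ(G)) containing no pair of false twin vertices. Then V(G) ∖ Γ is a resolving set for G. -/
open SimpleGraph Finset

variable {V : Type*}

/-- If every neighbor of `u` outside a minimum dominating set `Γ` is a neighbor of another
vertex `v` of `Γ`, then `u` has no neighbor in `Γ`. -/
lemma no_adj_of_min_dominating [Fintype V] [DecidableEq V] (G : SimpleGraph V)
    (Γ : Finset V) (hdom : IsDominatingSet G Γ) (hmin : Γ.card = dominationNumber G)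
    (u v : V) (hu : u ∈ Γ) (hv : v ∈ Γ) (huv : u ≠ v)
    (h : ∀ w, w ∉ Γ → G.Adj u w → G.Adj v w) : ∀ y ∈ Γ, ¬ G.Adj u y := by
  intro y hy hadj
  have hD : IsDominatingSet G (Γ.erase u) := by
    intro x hx
    by_cases hxu : x = u
    · subst hxu
      exact ⟨y, Finset.mem_erase.2 ⟨hadj.ne', hy⟩, hadj⟩
    · have hxΓ : x ∉ Γ := fun hh => hx (Finset.mem_erase.2 ⟨hxu, hh⟩)
      obtain ⟨z, hz, hxz⟩ := hdom x hxΓ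
      by_cases hzu : z = u
      · subst hzu
        exact ⟨v, Finset.mem_erase.2 ⟨huv.symm, hv⟩, (h x hxΓ hxz.symm).symm⟩
      · exact ⟨z, Finset.mem_erase.2 ⟨hzu, hz⟩, hxz⟩
  have h1 : dominationNumber G ≤ (Γ.erase u).card := Nat.sInf_le ⟨_, hD, rfl⟩
  have h2 := Finset.card_erase_lt_of_mem hu
  omega

/-- If `Γ` is a minimum dominating set of a connected graph `G` with no pair
of false twin vertices, then `V(G) \ Γ` is a resolving set for `G`. -/
theorem compl_of_min_dominating_set_no_false_twins_is_resolving
    [Fintype V] [DecidableEq V] (G : SimpleGraph V) (hG : G.Connected)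
    (Γ : Finset V) (hdom : IsDominatingSet G Γ) (hmin : Γ.card = dominationNumber G)
    (hft : ∀ u ∈ Γ, ∀ v ∈ Γ, u ≠ v → G.neighborSet u ≠ G.neighborSet v) :
    IsResolvingSet G Γᶜ := by
  intro u v huv
  by_contra! hcon
  have hu : u ∈ Γ := by
    by_contra hu
    have := hcon u (Finset.mem_compl.2 hu)
    rw [SimpleGraph.dist_self] at this
    exact huv ((hG.dist_eq_zero_iff).1 this.symm).symm
  have hv : v ∈ Γ := by
    by_contra hv
    have := hcon v (Finset.mem_compl.2 hv)
    rw [SimpleGraph.dist_self] at this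
    exact huv ((hG.dist_eq_zero_iff).1 this)
  have hadj : ∀ w, w ∉ Γ → (G.Adj u w ↔ G.Adj v w) := by
    intro w hw
    rw [← SimpleGraph.dist_eq_one_iff_adj, ← SimpleGraph.dist_eq_one_iff_adj,
      hcon w (Finset.mem_compl.2 hw)]
  have nu := no_adj_of_min_dominating G Γ hdom hmin u v hu hv huv
    (fun w hw => (hadj w hw).1)
  have nv := no_adj_of_min_dominating G Γ hdom hmin v u hv hu huv.symm
    (fun w hw => (hadj w hw).2)
  apply hft u hu v hv huv
  ext w
  rw [SimpleGraph.mem_neighborSet, SimpleGraph.mem_neighborSet]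
  by_cases hw : w ∈ Γ
  · exact ⟨fun h => (nu w hw h).elim, fun h => (nv w hw h).elim⟩
  · exact hadj w hw
end

section
/- For every finite simple connected graph G of order n, the metric dimension satisfies β(G) ≤ n − γ(G), where γ(G) is the domination number of G. -/
open SimpleGraph Finset

variable {V : Type*}

/-- Bollobás–Cockayne: some minimum dominating set has an external private neighbor for each
of its vertices. -/
lemma exists_private [Fintype V] [Nontrivial V] (G : SimpleGraph V) (hG : G.Connected) :
    ∃ Γ : Finset V, IsDominatingSet G Γ ∧ Γ.card = dominationNumber G ∧
      ∀ u ∈ Γ, ∃ w, w ∉ Γ ∧ G.Adj u w ∧ ∀ x ∈ Γ, G.Adj x w → x = u := by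
  classical
  have hne : {k | ∃ Γ : Finset V, IsDominatingSet G Γ ∧ Γ.card = k}.Nonempty :=
    ⟨_, Finset.univ, fun v hv => absurd (Finset.mem_univ v) hv, rfl⟩
  have hmin : ∀ Γ : Finset V, IsDominatingSet G Γ → dominationNumber G ≤ Γ.card :=
    fun Γ h => Nat.sInf_le ⟨Γ, h, rfl⟩
  obtain ⟨Γ₀, h₀, hc₀⟩ := Nat.sInf_mem hne
  let iso : Finset V → Finset V := fun Γ => Γ.filter (fun x => ∀ y ∈ Γ, ¬ G.Adj x y)
  obtain ⟨Γ, hΓ, hbest⟩ := Finset.exists_min_image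
    (Finset.univ.filter (fun Γ : Finset V => IsDominatingSet G Γ ∧ Γ.card = dominationNumber G))
    (fun Γ => (iso Γ).card) ⟨Γ₀, by simpa using ⟨h₀, hc₀⟩⟩
  simp only [Finset.mem_filter, Finset.mem_univ, true_and] at hΓ hbest
  obtain ⟨hdom, hcard⟩ := hΓ
  refine ⟨Γ, hdom, hcard, fun u hu => ?_⟩
  by_contra! hno
  -- `u` is isolated in `Γ`
  have hiso : ∀ y ∈ Γ, ¬ G.Adj u y := by
    intro y hy huy
    have hd : IsDominatingSet G (Γ.erase u) := by
      intro v hv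
      by_cases hvu : v = u
      · subst hvu
        exact ⟨y, Finset.mem_erase.2 ⟨huy.ne', hy⟩, huy⟩
      · have hvΓ : v ∉ Γ := fun h => hv (Finset.mem_erase.2 ⟨hvu, h⟩)
        obtain ⟨z, hz, hvz⟩ := hdom v hvΓ
        by_cases hzu : z = u
        · subst hzu
          obtain ⟨x, hx, hxv, hxz⟩ := hno v hvΓ hvz.symm
          exact ⟨x, Finset.mem_erase.2 ⟨hxz, hx⟩, hxv.symm⟩
        · exact ⟨z, Finset.mem_erase.2 ⟨hzu, hz⟩, hvz⟩
    have h1 := hmin _ hd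
    have h2 := Finset.card_erase_lt_of_mem hu
    omega
  obtain ⟨v, huv⟩ := hG.preconnected.exists_adj_of_nontrivial u
  have hvΓ : v ∉ Γ := fun h => hiso v h huv
  obtain ⟨x, hx, hxv, hxu⟩ := hno v hvΓ huv
  have hd : IsDominatingSet G (insert v (Γ.erase u)) := by
    intro t ht
    simp only [Finset.mem_insert, Finset.mem_erase, not_or, not_and] at ht
    by_cases htu : t = u
    · subst htu
      exact ⟨v, Finset.mem_insert_self _ _, huv⟩
    · have htΓ := ht.2 htu
      obtain ⟨z, hz, htz⟩ := hdom t htΓ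
      by_cases hzu : z = u
      · subst hzu
        obtain ⟨y, hy, hyt, hyz⟩ := hno t htΓ htz.symm
        exact ⟨y, by simp [hy, hyz], hyt.symm⟩
      · exact ⟨z, by simp [hz, hzu], htz⟩
  have hc : (insert v (Γ.erase u)).card = dominationNumber G := by
    rw [Finset.card_insert_of_notMem (by simp [hvΓ]), Finset.card_erase_add_one hu, hcard]
  have hle := hbest _ ⟨hd, hc⟩
  have hlt : (iso (insert v (Γ.erase u))).card < (iso Γ).card := by
    apply Finset.card_lt_card
    rw [Finset.ssubset_iff_of_subset]
    · refine ⟨u, by simpa [iso, hu] using hiso, ?_⟩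
      simp [iso, huv.ne]
    · intro t ht
      simp only [iso, Finset.mem_filter, Finset.mem_insert, Finset.mem_erase] at ht ⊢
      obtain ⟨ht1, ht2⟩ := ht
      rcases ht1 with rfl | ⟨htu, htΓ⟩
      · exact absurd hxv.symm (ht2 x (Or.inr ⟨hxu, hx⟩))
      · refine ⟨htΓ, fun y hy hty => ?_⟩
        by_cases hyu : y = u
        · subst hyu
          exact hiso t htΓ hty.symm
        · exact ht2 y (Or.inr ⟨hyu, hy⟩) hty
  omega

/-- For every connected graph `G` of order `n`, `β(G) ≤ n - γ(G)`. -/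
theorem metricDimension_le_card_sub_dominationNumber [Fintype V]
    (G : SimpleGraph V) (hG : G.Connected) :
    metricDimension G ≤ Fintype.card V - dominationNumber G := by
  classical
  rcases subsingleton_or_nontrivial V with hV | hV
  · have : metricDimension G ≤ 0 :=
      Nat.sInf_le ⟨∅, fun u v huv => absurd (Subsingleton.elim u v) huv, rfl⟩
    omega
  · obtain ⟨Γ, -, hcard, hpriv⟩ := exists_private G hG
    refine Nat.sInf_le ⟨Γᶜ, ?_, by rw [Finset.card_compl, hcard]⟩
    intro u v huv
    by_cases hu : u ∈ Γ
    · obtain ⟨w, hw, huw, hx⟩ := hpriv u hu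
      by_cases hv : v ∈ Γ
      · refine ⟨w, by simpa using hw, fun h => ?_⟩
        rw [SimpleGraph.dist_eq_one_iff_adj.2 huw] at h
        exact huv (hx v hv (SimpleGraph.dist_eq_one_iff_adj.1 h.symm)).symm
      · refine ⟨v, by simpa using hv, ?_⟩
        rw [SimpleGraph.dist_self]
        exact (hG.pos_dist_of_ne huv).ne'
    · refine ⟨u, by simpa using hu, ?_⟩
      rw [SimpleGraph.dist_self]
      exact (hG.pos_dist_of_ne huv.symm).ne
end

section
/- Let G be a finite simple connected graph of order n. If β(G) = n − γ(G), then G is a complete graph K_n, or G is a complete bipartite graph K_{s,t} for some integers s, t ≥ 2. -/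
open SimpleGraph Finset

variable {V : Type*}

theorem aux_dist_le_two {G : SimpleGraph V} {a m b : V} (h1 : G.Adj a m) (h2 : G.Adj m b) :
    G.dist a b ≤ 2 := by
  simpa using SimpleGraph.dist_le (Walk.cons h1 (Walk.cons h2 Walk.nil))

theorem aux_of_dist_le_two {G : SimpleGraph V} (hG : G.Connected) {a b : V} (hab : a ≠ b)
    (h : G.dist a b ≤ 2) : G.Adj a b ∨ ∃ m, G.Adj a m ∧ G.Adj m b := by
  obtain ⟨p, hp⟩ := hG.exists_walk_length_eq_dist a b
  match p, hp with
  | .nil, _ => exact absurd rfl hab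
  | .cons h1 .nil, _ => exact Or.inl h1
  | .cons h1 (.cons h2 .nil), _ => exact Or.inr ⟨_, h1, h2⟩
  | .cons h1 (.cons h2 (.cons h3 p)), hp =>
    simp only [Walk.length_cons] at hp
    omega

/-- vertices at the same distance from `w`: adjacency transfers -/
theorem aux_adj {G : SimpleGraph V} {a b w : V} (h : G.dist a w = G.dist b w)
    (hb : G.Adj a w) : G.Adj b w := by
  rw [← SimpleGraph.dist_eq_one_iff_adj] at hb ⊢
  omega

theorem aux_two {G : SimpleGraph V} (hG : G.Connected) {a b w m : V}
    (h : G.dist a w = G.dist b w) (hbw : b ≠ w)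
    (h1 : G.Adj a m) (h2 : G.Adj m w) : G.Adj b w ∨ ∃ m, G.Adj b m ∧ G.Adj m w :=
  aux_of_dist_le_two hG hbw (h ▸ aux_dist_le_two h1 h2)

theorem aux_closed {G : SimpleGraph V} (hG : G.Connected) (C : V → Prop) (x : V) (hx : C x)
    (hC : ∀ v z, C v → G.Adj v z → C z) (z : V) : C z := by
  obtain ⟨p⟩ := hG.preconnected x z
  induction p with
  | nil => exact hx
  | cons h p ih => exact ih (hC _ _ hx h)

theorem aux_nonres [Fintype V] (G : SimpleGraph V) (hG : G.Connected)
    (h : metricDimension G = Fintype.card V - dominationNumber G)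
    (T : Finset V) (hT : dominationNumber G < T.card) :
    ∃ u ∈ T, ∃ v ∈ T, u ≠ v ∧ ∀ w, w ∉ T → G.dist u w = G.dist v w := by
  classical
  by_contra hcon
  push Not at hcon
  have hres : IsResolvingSet G Tᶜ := by
    intro u v huv
    by_cases hu : u ∈ T
    · by_cases hv : v ∈ T
      · obtain ⟨w, hw, hne⟩ := hcon u hu v hv huv
        exact ⟨w, by simpa using hw, hne⟩
      · refine ⟨v, by simpa using hv, ?_⟩
        have := hG.pos_dist_of_ne huv
        simp only [SimpleGraph.dist_self]
        omega
    · refine ⟨u, by simpa using hu, ?_⟩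
      have := hG.pos_dist_of_ne huv.symm
      simp only [SimpleGraph.dist_self]
      omega
  have h1 : metricDimension G ≤ (Tᶜ).card := Nat.sInf_le ⟨_, hres, rfl⟩
  rw [Finset.card_compl] at h1
  have := T.card_le_univ
  omega

/-- Bollobás–Cockayne: a minimum dominating set in which each vertex has an external
private neighbor. -/
theorem aux_bc [Fintype V] [Nontrivial V] (G : SimpleGraph V) (hG : G.Connected) :
    ∃ Γ : Finset V, Γ.card = dominationNumber G ∧ (∀ v, v ∉ Γ → ∃ u ∈ Γ, G.Adj u v) ∧
      ∀ x ∈ Γ, ∃ p, p ∉ Γ ∧ G.Adj x p ∧ ∀ u ∈ Γ, G.Adj u p → u = x := by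
  classical
  have hne : {k | ∃ Γ : Finset V, IsDominatingSet G Γ ∧ Γ.card = k}.Nonempty :=
    ⟨_, Finset.univ, fun v hv => absurd (Finset.mem_univ v) hv, rfl⟩
  obtain ⟨Γ₀, hΓ₀, hc₀⟩ := Nat.sInf_mem hne
  have hmin : ∀ Γ : Finset V, IsDominatingSet G Γ → dominationNumber G ≤ Γ.card :=
    fun Γ hΓ => Nat.sInf_le ⟨Γ, hΓ, rfl⟩
  let F : Finset V → Finset V := fun Γ => Γ.filter (fun x => ∀ u ∈ Γ, ¬ G.Adj x u)
  obtain ⟨Γ, hΓm, hΓmin⟩ := Finset.exists_min_image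
    (Finset.univ.filter (fun Γ : Finset V => IsDominatingSet G Γ ∧ Γ.card = dominationNumber G))
    (fun Γ => (F Γ).card) ⟨Γ₀, by simp only [Finset.mem_filter, Finset.mem_univ, true_and]; exact ⟨hΓ₀, hc₀⟩⟩
  simp only [Finset.mem_filter, Finset.mem_univ, true_and] at hΓm hΓmin
  obtain ⟨hd, hc⟩ := hΓm
  refine ⟨Γ, hc, fun v hv => (hd v hv).imp fun u hu => ⟨hu.1, hu.2.symm⟩, ?_⟩
  intro x hx
  by_contra hcon
  push Not at hcon
  have hiso : ∀ u ∈ Γ, ¬ G.Adj x u := by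
    intro u hu hxu
    have : IsDominatingSet G (Γ.erase x) := by
      intro v hv
      by_cases hvx : v = x
      · subst hvx
        exact ⟨u, Finset.mem_erase.2 ⟨hxu.ne', hu⟩, hxu⟩
      · have hvΓ : v ∉ Γ := fun h => hv (Finset.mem_erase.2 ⟨hvx, h⟩)
        obtain ⟨a, ha, hva⟩ := hd v hvΓ
        by_cases hax : a = x
        · subst hax
          obtain ⟨b, hb, hbv, hne⟩ := hcon v hvΓ hva.symm
          exact ⟨b, Finset.mem_erase.2 ⟨hne, hb⟩, hbv.symm⟩
        · exact ⟨a, Finset.mem_erase.2 ⟨hax, ha⟩, hva⟩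
    have h1 := hmin _ this
    have h2 := Finset.card_erase_lt_of_mem hx
    omega
  obtain ⟨y, hxy⟩ := hG.preconnected.exists_adj_of_nontrivial x
  have hy : y ∉ Γ := fun h => hiso y h hxy
  obtain ⟨b, hb, hby, hbx⟩ := hcon y hy hxy
  let Γ' := insert y (Γ.erase x)
  have hyE : y ∉ Γ.erase x := fun h => hy (Finset.mem_of_mem_erase h)
  have hcard : Γ'.card = Γ.card := by
    rw [Finset.card_insert_of_notMem hyE, Finset.card_erase_add_one hx]
  have hbΓ' : b ∈ Γ' := Finset.mem_insert_of_mem (Finset.mem_erase.2 ⟨hbx, hb⟩)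
  have hd' : IsDominatingSet G Γ' := by
    intro v hv
    by_cases hvx : v = x
    · subst hvx
      exact ⟨y, Finset.mem_insert_self _ _, hxy⟩
    · have hvΓ : v ∉ Γ := fun h => hv (Finset.mem_insert_of_mem (Finset.mem_erase.2 ⟨hvx, h⟩))
      obtain ⟨a, ha, hva⟩ := hd v hvΓ
      by_cases hax : a = x
      · subst hax
        obtain ⟨b, hb, hbv, hne⟩ := hcon v hvΓ hva.symm
        exact ⟨b, Finset.mem_insert_of_mem (Finset.mem_erase.2 ⟨hne, hb⟩), hbv.symm⟩
      · exact ⟨a, Finset.mem_insert_of_mem (Finset.mem_erase.2 ⟨hax, ha⟩), hva⟩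
  have hle := hΓmin Γ' ⟨hd', hcard.trans hc⟩
  have hss : F Γ' ⊂ F Γ := by
    rw [Finset.ssubset_iff_of_subset]
    · refine ⟨x, Finset.mem_filter.2 ⟨hx, hiso⟩, ?_⟩
      intro hxF
      have := (Finset.mem_filter.1 hxF).1
      rcases Finset.mem_insert.1 this with h | h
      · exact hxy.ne h
      · simp at h
    · intro z hz
      obtain ⟨hz1, hz2⟩ := Finset.mem_filter.1 hz
      rcases Finset.mem_insert.1 hz1 with h | h
      · subst h
        exact absurd hby.symm (hz2 b hbΓ')
      · have hzΓ := Finset.mem_of_mem_erase h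
        refine Finset.mem_filter.2 ⟨hzΓ, fun u hu hzu => ?_⟩
        by_cases hux : u = x
        · subst hux
          exact hiso z hzΓ hzu.symm
        · exact hz2 u (Finset.mem_insert_of_mem (Finset.mem_erase.2 ⟨hux, hu⟩)) hzu
  have := Finset.card_lt_card hss
  omega

/-- The map `f` from outside vertices to their twins in `Γ`. -/
theorem aux_twin (G : SimpleGraph V) (Γ : Finset V)
    (hP : ∀ x ∈ Γ, ∃ p, p ∉ Γ ∧ G.Adj x p ∧ ∀ u ∈ Γ, G.Adj u p → u = x)
    (H : ∀ T : Finset V, Γ.card < T.card →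
      ∃ u ∈ T, ∃ v ∈ T, u ≠ v ∧ ∀ w, w ∉ T → G.dist u w = G.dist v w)
    (y : V) (hy : y ∉ Γ) :
    ∃ x ∈ Γ, ∀ w, w ∉ Γ → w ≠ y → G.dist y w = G.dist x w := by
  classical
  obtain ⟨u, hu, v, hv, huv, hw⟩ := H (insert y Γ)
    (by rw [Finset.card_insert_of_notMem hy]; omega)
  have hw' : ∀ w, w ∉ Γ → w ≠ y → G.dist u w = G.dist v w := by
    intro w h1 h2
    exact hw w (by simp [h1, h2])
  rcases Finset.mem_insert.1 hu with rfl | hu2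
  · rcases Finset.mem_insert.1 hv with rfl | hv
    · exact absurd rfl huv
    · exact ⟨v, hv, hw'⟩
  · rcases Finset.mem_insert.1 hv with rfl | hv
    · exact ⟨u, hu2, fun w h1 h2 => (hw' w h1 h2).symm⟩
    · exfalso
      obtain ⟨p, hp, hup, hpu⟩ := hP u hu2
      obtain ⟨r, hr, hvr, hrv⟩ := hP v hv
      by_cases hpy : p = y
      · by_cases hry : r = y
        · subst hpy
          subst hry
          exact huv (hrv u hu2 hup)
        · exact huv (hrv u hu2 (aux_adj (hw' r hr hry).symm hvr))
      · exact huv (hpu v hv (aux_adj (hw' p hp hpy) hup)).symm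

/-- If some private neighbor of `x` is a twin of `x`, then `Γ = {x}`. -/
theorem aux_typeB (G : SimpleGraph V) (hG : G.Connected) (Γ : Finset V)
    (hP : ∀ x ∈ Γ, ∃ p, p ∉ Γ ∧ G.Adj x p ∧ ∀ u ∈ Γ, G.Adj u p → u = x)
    (f : V → V) (hfΓ : ∀ y, y ∉ Γ → f y ∈ Γ)
    (hf : ∀ y, y ∉ Γ → ∀ w, w ∉ Γ → w ≠ y → G.dist y w = G.dist (f y) w)
    (x p : V) (hp : p ∉ Γ) (hxp : G.Adj x p)
    (hpx : ∀ u ∈ Γ, G.Adj u p → u = x) (hfp : f p = x) : ∀ z ∈ Γ, z = x := by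
  have hN : ∀ w, w ∉ Γ → G.Adj x w → f w = x := by
    intro w hw hxw
    by_cases hwp : w = p
    · rw [hwp, hfp]
    · have h1 : G.Adj p w := aux_adj (a := x) (by rw [hf p hp w hw hwp, hfp]) hxw
      exact hpx _ (hfΓ w hw) (aux_adj (hf w hw p hp (Ne.symm hwp)) h1.symm)
  have K : ∀ p', p' ∉ Γ → p' ≠ p → ¬ G.Adj x p' → ∀ m, G.Adj x m → G.Adj m p' → False := by
    intro p' hp' hne hna m hxm hmp'
    have e : G.dist p p' = G.dist x p' := by rw [hf p hp p' hp' hne, hfp]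
    rcases aux_two hG e.symm hne.symm hxm hmp' with h | ⟨m, h1, h2⟩
    · exact hna (aux_adj e h)
    · by_cases hm : m ∈ Γ
      · exact hna (hpx m hm h1.symm ▸ h2)
      · have hxm : G.Adj x m := by
          have := aux_adj (hf p hp m hm h1.ne') h1
          rwa [hfp] at this
        have := aux_adj (hf m hm p' hp' h2.ne') h2
        rw [hN m hm hxm] at this
        exact hna this
  have hC := aux_closed hG (fun v => v = x ∨ (v ∉ Γ ∧ G.Adj x v)) x (Or.inl rfl) (by
    rintro v z (rfl | ⟨hv, hxv⟩) hvz
    · by_cases hz : z ∈ Γ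
      · exfalso
        obtain ⟨p', hp', hzp', hu⟩ := hP z hz
        refine K p' hp' ?_ ?_ z hvz hzp'
        · rintro rfl
          exact hvz.ne' (hpx z hz hzp')
        · intro h
          have hvΓ : v ∈ Γ := hfp ▸ hfΓ p hp
          exact hvz.ne (hu v hvΓ h)
      · exact Or.inr ⟨hz, hvz⟩
    · by_cases hzx : z = x
      · exact Or.inl hzx
      right
      have hxΓ : x ∈ Γ := hfp ▸ hfΓ p hp
      have hfv := hN v hv hxv
      by_cases hz : z ∈ Γ
      · exfalso
        obtain ⟨p', hp', hzp', hu⟩ := hP z hz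
        have hna : ¬ G.Adj x p' := fun h => hzx (hu x hxΓ h).symm
        have hne : p' ≠ v := by
          rintro rfl
          exact hna hxv
        have e := hf v hv p' hp' hne
        rw [hfv] at e
        have hxp' : x ≠ p' := fun h => hp' (h ▸ hxΓ)
        rcases aux_two hG e hxp' hvz hzp' with h | ⟨m, h1, h2⟩
        · exact hna h
        · refine K p' hp' ?_ hna m h1 h2
          rintro rfl
          exact hna hxp
      · refine ⟨hz, ?_⟩
        have := aux_adj (hf v hv z hz hvz.ne') hvz
        rwa [hfv] at this)
  intro z hz
  rcases hC z with h | ⟨h, _⟩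
  · exact h
  · exact absurd hz h

/-- Half of the pairing: all outside neighbors of `x` are twins of `q`. -/
theorem aux_pair (G : SimpleGraph V) (Γ : Finset V)
    (f : V → V) (hfΓ : ∀ y, y ∉ Γ → f y ∈ Γ)
    (hf : ∀ y, y ∉ Γ → ∀ w, w ∉ Γ → w ≠ y → G.dist y w = G.dist (f y) w)
    (x q r : V) (hx : x ∈ Γ) (hxq : x ≠ q) (hr : r ∉ Γ)
    (hrq : ∀ u ∈ Γ, G.Adj u r → u = q) (hfr : f r = x) :
    ∀ w, w ∉ Γ → G.Adj x w → f w = q := by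
  intro w hw hxw
  have hne : w ≠ r := by
    rintro rfl
    exact hxq (hrq x hx hxw)
  have h1 : G.Adj r w := aux_adj (a := x) (by rw [hf r hr w hw hne, hfr]) hxw
  exact hrq _ (hfΓ w hw) (aux_adj (hf w hw r hr hne.symm) h1.symm)

theorem aux_iso [Fintype V] (G : SimpleGraph V) (A : V → Prop)
    (hA : ∀ u v, G.Adj u v ↔ ¬ (A u ↔ A v))
    (a b c d : V) (hab : a ≠ b) (hcd : c ≠ d) (ha : A a) (hb : A b) (hc : ¬ A c) (hd : ¬ A d) :
    ∃ s t : ℕ, 2 ≤ s ∧ 2 ≤ t ∧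
      Nonempty (G ≃g completeBipartiteGraph (Fin s) (Fin t)) := by
  classical
  refine ⟨Fintype.card {v // A v}, Fintype.card {v // ¬ A v}, ?_, ?_, ?_⟩
  · exact Fintype.one_lt_card_iff.2 ⟨⟨a, ha⟩, ⟨b, hb⟩, by simpa using hab⟩
  · exact Fintype.one_lt_card_iff.2 ⟨⟨c, hc⟩, ⟨d, hd⟩, by simpa using hcd⟩
  · let e : V ≃ Fin (Fintype.card {v // A v}) ⊕ Fin (Fintype.card {v // ¬ A v}) :=
      (Equiv.sumCompl A).symm.trans
        (Equiv.sumCongr (Fintype.equivFin _) (Fintype.equivFin _))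
    have hl : ∀ v, A v → (e v).isLeft = true ∧ (e v).isRight = false := by
      intro v hv
      simp [e, Equiv.sumCompl_symm_apply_of_pos hv]
    have hr : ∀ v, ¬ A v → (e v).isLeft = false ∧ (e v).isRight = true := by
      intro v hv
      simp [e, Equiv.sumCompl_symm_apply_of_neg hv]
    refine ⟨⟨e, ?_⟩⟩
    intro u v
    rw [completeBipartiteGraph_adj, hA]
    by_cases hu : A u <;> by_cases hv : A v <;>
      simp [hu, hv, hl, hr]

theorem aux_core [Fintype V] (G : SimpleGraph V) (hG : G.Connected) (Γ : Finset V)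
    (hne : 2 ≤ Γ.card)
    (hD : ∀ v, v ∉ Γ → ∃ u ∈ Γ, G.Adj u v)
    (hP : ∀ x ∈ Γ, ∃ p, p ∉ Γ ∧ G.Adj x p ∧ ∀ u ∈ Γ, G.Adj u p → u = x)
    (H : ∀ T : Finset V, Γ.card < T.card →
      ∃ u ∈ T, ∃ v ∈ T, u ≠ v ∧ ∀ w, w ∉ T → G.dist u w = G.dist v w) :
    ∃ s t : ℕ, 2 ≤ s ∧ 2 ≤ t ∧
      Nonempty (G ≃g completeBipartiteGraph (Fin s) (Fin t)) := by
  classical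
  have hex : ∀ y, ∃ x, y ∉ Γ → x ∈ Γ ∧ ∀ w, w ∉ Γ → w ≠ y → G.dist y w = G.dist x w := by
    intro y
    by_cases hy : y ∈ Γ
    · exact ⟨y, fun h => absurd hy h⟩
    · obtain ⟨x, h1, h2⟩ := aux_twin G Γ hP H y hy
      exact ⟨x, fun _ => ⟨h1, h2⟩⟩
  choose f hf0 using hex
  have hfΓ : ∀ y, y ∉ Γ → f y ∈ Γ := fun y hy => (hf0 y hy).1
  have hf : ∀ y, y ∉ Γ → ∀ w, w ∉ Γ → w ≠ y → G.dist y w = G.dist (f y) w :=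
    fun y hy => (hf0 y hy).2
  have hpart : ∀ x, ∃ q, x ∈ Γ → q ∈ Γ ∧ x ≠ q ∧ (∀ w, w ∉ Γ → G.Adj x w → f w = q) ∧
      (∀ w, w ∉ Γ → G.Adj q w → f w = x) := by
    intro x
    by_cases hx : x ∈ Γ
    swap
    · exact ⟨x, fun h => absurd h hx⟩
    obtain ⟨p, hp, hxp, hpx⟩ := hP x hx
    have hxq : x ≠ f p := by
      intro h
      have hall := aux_typeB G hG Γ hP f hfΓ hf x p hp hxp hpx h.symm
      have : Γ.card ≤ 1 := Finset.card_le_one.2 fun a ha b hb => by rw [hall a ha, hall b hb]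
      omega
    have hq := hfΓ p hp
    obtain ⟨r, hr, hqr, hrq⟩ := hP (f p) hq
    have hpr : r ≠ p := by
      rintro rfl
      exact hxq (hpx _ hq hqr).symm
    have hadj : G.Adj p r := aux_adj (hf p hp r hr hpr).symm hqr
    have hfr : f r = x :=
      hpx _ (hfΓ r hr) (aux_adj (hf r hr p hp hpr.symm) hadj.symm)
    exact ⟨f p, fun _ => ⟨hq, hxq,
      aux_pair G Γ f hfΓ hf x (f p) r hx hxq hr hrq hfr,
      aux_pair G Γ f hfΓ hf (f p) x p hq hxq.symm hp hpx rfl⟩⟩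
  choose g hg using hpart
  have huniq : ∀ w, w ∉ Γ → ∀ x ∈ Γ, ∀ x' ∈ Γ, G.Adj x w → G.Adj x' w → x = x' := by
    intro w hw x hx x' hx' h h'
    have e : g x = g x' := ((hg x hx).2.2.1 w hw h).symm.trans ((hg x' hx').2.2.1 w hw h')
    obtain ⟨r, hr, hqr, -⟩ := hP (g x) (hg x hx).1
    exact ((hg x hx).2.2.2 r hr hqr).symm.trans ((hg x' hx').2.2.2 r hr (e ▸ hqr))
  have hgg : ∀ x ∈ Γ, g (g x) = x := by
    intro x hx
    obtain ⟨r, hr, hqr, -⟩ := hP (g x) (hg x hx).1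
    exact ((hg _ (hg x hx).1).2.2.1 r hr hqr).symm.trans ((hg x hx).2.2.2 r hr hqr)
  have hS : ∀ x ∈ Γ, ∀ w, w ∉ Γ → G.Adj x w → ∀ z, z ∉ Γ → (G.Adj w z ↔ G.Adj (g x) z) := by
    intro x hx w hw hxw z hz
    have hfw := (hg x hx).2.2.1 w hw hxw
    constructor
    · intro h
      have := aux_adj (hf w hw z hz h.ne') h
      rwa [hfw] at this
    · intro h
      have hne : z ≠ w := by
        rintro rfl
        exact (hg x hx).2.1 (huniq z hz x hx _ (hg x hx).1 hxw h)
      have e := hf w hw z hz hne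
      rw [hfw] at e
      exact aux_adj e.symm h
  have hE : ∀ x ∈ Γ, ∀ x' ∈ Γ, G.Adj x x' → x' = g x := by
    intro x hx x' hx' hxx'
    by_contra hcon
    have hq := (hg x hx).1
    obtain ⟨p', hp', hxp', -⟩ := hP x' hx'
    obtain ⟨r, hr, hqr, -⟩ := hP (g x) hq
    have hpr : p' ≠ r := by
      rintro rfl
      exact hcon (huniq p' hp' x' hx' _ hq hxp' hqr)
    have e := hf r hr p' hp' hpr
    rw [(hg x hx).2.2.2 r hr hqr] at e
    rcases aux_two hG e.symm hpr.symm hxx' hxp' with h | ⟨m, h1, h2⟩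
    · rw [hS _ hq r hr hqr p' hp', hgg x hx] at h
      exact hxx'.ne (huniq p' hp' x hx x' hx' h hxp')
    · by_cases hm : m ∈ Γ
      · exact hcon ((huniq p' hp' x' hx' m hm hxp' h2).trans
          (huniq r hr m hm _ hq h1.symm hqr))
      · rw [hS _ hq r hr hqr m hm, hgg x hx] at h1
        have h3 := (hS x' hx' p' hp' hxp' m hm).1 h2.symm
        have h4 := huniq m hm x hx _ (hg x' hx').1 h1 h3
        exact hcon (by rw [h4, hgg x' hx'])
  obtain ⟨x, hx⟩ : Γ.Nonempty := Finset.card_pos.1 (by omega)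
  obtain ⟨hq, hxq, hfx, hfq⟩ := hg x hx
  have hggx := hgg x hx
  obtain ⟨p, hp, hxp, -⟩ := hP x hx
  obtain ⟨r, hr, hqr, -⟩ := hP (g x) hq
  generalize hqdef : g x = q at *
  have hSx := hS x hx
  have hSq := hS q hq
  rw [hqdef] at hSx
  rw [hggx] at hSq
  have hEx := hE x hx
  have hEq := hE q hq
  rw [hqdef] at hEx
  rw [hggx] at hEq
  have hall := aux_closed hG
    (fun v => v = x ∨ v = q ∨ (v ∉ Γ ∧ G.Adj x v) ∨ (v ∉ Γ ∧ G.Adj q v)) x (Or.inl rfl) (by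
    rintro v z (rfl | rfl | ⟨hv, hxv⟩ | ⟨hv, hxv⟩) hvz
    · by_cases hz : z ∈ Γ
      · exact Or.inr (Or.inl (hEx z hz hvz))
      · exact Or.inr (Or.inr (Or.inl ⟨hz, hvz⟩))
    · by_cases hz : z ∈ Γ
      · exact Or.inl (hEq z hz hvz)
      · exact Or.inr (Or.inr (Or.inr ⟨hz, hvz⟩))
    · by_cases hz : z ∈ Γ
      · exact Or.inl (huniq v hv z hz x hx hvz.symm hxv)
      · exact Or.inr (Or.inr (Or.inr ⟨hz, (hSx v hv hxv z hz).1 hvz⟩))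
    · by_cases hz : z ∈ Γ
      · exact Or.inr (Or.inl (huniq v hv z hz q hq hvz.symm hxv))
      · exact Or.inr (Or.inr (Or.inl ⟨hz, (hSq v hv hxv z hz).1 hvz⟩)))
  have hΓ : ∀ z ∈ Γ, z = x ∨ z = q := by
    intro z hz
    rcases hall z with h | h | h | h
    · exact Or.inl h
    · exact Or.inr h
    · exact absurd hz h.1
    · exact absurd hz h.1
  have hxr : ¬ G.Adj x r := fun h => hxq (huniq r hr x hx q hq h hqr)
  have hqp : ¬ G.Adj q p := fun h => hxq (huniq p hp x hx q hq hxp h)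
  have hpr : G.Adj p r := (hSx p hp hxp r hr).2 hqr
  have hxne : ∀ w, w ∉ Γ → x ≠ w := fun w hw h => hw (h ▸ hx)
  have hqne : ∀ w, w ∉ Γ → q ≠ w := fun w hw h => hw (h ▸ hq)
  by_cases hadj : G.Adj x q
  ·
    refine aux_iso G (fun v => G.Adj x v) ?_ q p x r (hqne p hp) (hxne r hr) hadj hxp
      (G.irrefl) hxr
    have hnot : ∀ w, w ∉ Γ → G.Adj q w → ¬ G.Adj x w :=
      fun w hw h h' => hxq (huniq w hw x hx q hq h' h)
    intro u v
    rcases hall u with rfl | rfl | ⟨hu, hu'⟩ | ⟨hu, hu'⟩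
    · simp
    · rcases hall v with rfl | rfl | ⟨hv, hv'⟩ | ⟨hv, hv'⟩
      · simp [hadj, hadj.symm]
      · simp
      · simpa [hadj, hv'] using fun h => hnot v hv h hv'
      · simp [hadj, hv', hnot v hv hv']
    · rcases hall v with rfl | rfl | ⟨hv, hv'⟩ | ⟨hv, hv'⟩
      · simp [hu', hu'.symm]
      · simpa [hadj, hu'] using fun h => hnot u hu (SimpleGraph.Adj.symm h) hu'
      · simpa [hSx u hu hu' v hv, hu', hv'] using fun h => hnot v hv h hv'
      · simp [hSx u hu hu' v hv, hu', hv', hnot v hv hv']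
    · have hn := hnot u hu hu'
      rcases hall v with rfl | rfl | ⟨hv, hv'⟩ | ⟨hv, hv'⟩
      · simpa [hn] using fun h => hn (SimpleGraph.Adj.symm h)
      · simp [hn, hadj, hu'.symm]
      · simp [hSq u hu hu' v hv, hn, hv']
      · simp [hSq u hu hu' v hv, hn, hnot v hv hv']
  · exfalso
    have hΓc : Γ.card ≤ 2 := by
      have : Γ ⊆ {x, q} := fun z hz => by simpa using hΓ z hz
      exact (Finset.card_le_card this).trans Finset.card_le_two
    have hTc : ({p, r, x} : Finset V).card = 3 :=
      Finset.card_eq_three.2 ⟨p, r, x, hpr.ne, (hxne p hp).symm, (hxne r hr).symm, rfl⟩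
    obtain ⟨u, hu, v, hv, huv, hw⟩ := H {p, r, x} (by omega)
    have hd := hw q (by simp [hqne p hp, hqne r hr, hxq.symm])
    have hpq : ¬ G.Adj p q := fun h => hqp h.symm
    have hK : G.dist p q ≠ G.dist x q := by
      intro e
      rcases aux_two hG e hxq hpr hqr.symm with h | ⟨m, h1, h2⟩
      · exact hadj h
      · by_cases hm : m ∈ Γ
        · rcases hΓ m hm with rfl | rfl
          · exact G.irrefl h1
          · exact G.irrefl h2
        · exact hxq (huniq m hm x hx q hq h1 h2.symm)
    have hK2 : G.dist r q ≠ G.dist x q := fun e => hadj (aux_adj e hqr.symm)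
    have hK3 : G.dist r q ≠ G.dist p q := fun e => hpq (aux_adj e hqr.symm)
    simp only [Finset.mem_insert, Finset.mem_singleton] at hu hv
    rcases hu with rfl | rfl | rfl <;> rcases hv with rfl | rfl | rfl <;>
      first
      | exact huv rfl
      | exact hK hd
      | exact hK hd.symm
      | exact hK2 hd
      | exact hK2 hd.symm
      | exact hK3 hd
      | exact hK3 hd.symm

/-- If `G` is connected of order `n` and `β(G) = n - γ(G)`, then `G` is a
complete graph, or a complete bipartite graph `K_{s,t}` with `s, t ≥ 2`. -/
theorem eq_card_sub_dominationNumber_iff_complete_or_completeBipartite [Fintype V]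
    (G : SimpleGraph V) (hG : G.Connected)
    (h : metricDimension G = Fintype.card V - dominationNumber G) :
    G = ⊤ ∨ ∃ s t : ℕ, 2 ≤ s ∧ 2 ≤ t ∧
      Nonempty (G ≃g completeBipartiteGraph (Fin s) (Fin t)) := by
  classical
  rcases subsingleton_or_nontrivial V with hV | hV
  · left
    ext a b
    simp [Subsingleton.elim a b]
  obtain ⟨Γ, hc, hD, hP⟩ := aux_bc G hG
  have H : ∀ T : Finset V, Γ.card < T.card →
      ∃ u ∈ T, ∃ v ∈ T, u ≠ v ∧ ∀ w, w ∉ T → G.dist u w = G.dist v w :=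
    fun T hT => aux_nonres G hG h T (hc ▸ hT)
  by_cases h2 : 2 ≤ Γ.card
  · exact Or.inr (aux_core G hG Γ h2 hD hP H)
  left
  have htw : ∀ a b : V, a ≠ b → ∀ w, w ≠ a → w ≠ b → G.dist a w = G.dist b w := by
    intro a b hab w hwa hwb
    obtain ⟨u, hu, v, hv, huv, hw⟩ := H {a, b} (by rw [Finset.card_pair hab]; omega)
    have hd := hw w (by simp [hwa, hwb])
    simp only [Finset.mem_insert, Finset.mem_singleton] at hu hv
    rcases hu with rfl | rfl <;> rcases hv with rfl | rfl
    · exact absurd rfl huv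
    · exact hd
    · exact hd.symm
    · exact absurd rfl huv
  have h1 : ∀ a ∈ Γ, ∀ b ∈ Γ, a = b := Finset.card_le_one.1 (by omega)
  have hdom : ∀ a ∈ Γ, ∀ b, b ≠ a → G.Adj a b := by
    intro a ha b hba
    obtain ⟨u, hu, hub⟩ := hD b (fun hb => hba (h1 b hb a ha))
    exact h1 u hu a ha ▸ hub
  ext a b
  rw [SimpleGraph.top_adj]
  refine ⟨fun hab => hab.ne, fun hab => ?_⟩
  by_cases ha : a ∈ Γ
  · exact hdom a ha b hab.symm
  by_cases hb : b ∈ Γ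
  · exact (hdom b hb a hab).symm
  obtain ⟨x, hx, hxa⟩ := hD a ha
  have hbx : b ≠ x := fun e => hb (e ▸ hx)
  exact aux_adj (htw x a hxa.ne b hbx hab.symm) (hdom x hx b hbx)
end

section
/- If G is a finite simple connected graph of order n, then β(G) ≤ n − diam(G), where diam(G) is the diameter of G. -/
open SimpleGraph Finset

variable {V : Type*}

/-- For a connected graph `G` of order `n`, `β(G) ≤ n - diam(G)`. -/
theorem metricDimension_le_card_sub_diam [Fintype V]
    (G : SimpleGraph V) (hG : G.Connected) :
    metricDimension G ≤ Fintype.card V - G.diam := by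
  classical
  haveI := hG.nonempty
  obtain ⟨u, v, huv⟩ := G.exists_dist_eq_diam
  obtain ⟨p, hp⟩ := hG.exists_walk_length_eq_dist u v
  have hd : ∀ i, i ≤ G.diam → G.dist u (p.getVert i) = i := by
    intro i hi
    have h1 := G.dist_le (p.take i)
    have h2 := G.dist_le (p.drop i)
    have h3 := hG.dist_triangle (u := u) (v := p.getVert i) (w := v)
    rw [Walk.take_length] at h1
    rw [Walk.drop_length] at h2
    have h4 := min_le_left i p.length
    omega
  let R : Finset V := (Finset.Icc 1 G.diam).image p.getVert
  have hR : R.card = G.diam := by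
    rw [Finset.card_image_of_injOn]
    · simp
    · intro i hi j hj hij
      simp only [Finset.coe_Icc, Set.mem_Icc] at hi hj
      rw [← hd i hi.2, ← hd j hj.2]
      exact congrArg _ hij
  have hRd : ∀ x ∈ R, 1 ≤ G.dist u x ∧ p.getVert (G.dist u x) = x := by
    intro x hx
    obtain ⟨i, hi, rfl⟩ := Finset.mem_image.1 hx
    rw [Finset.mem_Icc] at hi
    rw [hd i hi.2]
    exact ⟨hi.1, rfl⟩
  refine Nat.sInf_le ⟨Rᶜ, ?_, by rw [Finset.card_compl, hR]⟩
  intro x y hxy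
  by_cases hx : x ∈ R
  · by_cases hy : y ∈ R
    · refine ⟨u, ?_, ?_⟩
      · rw [Finset.mem_compl]
        intro hu
        have := (hRd u hu).1
        simp at this
      · intro h
        rw [G.dist_comm, G.dist_comm (u := y)] at h
        apply hxy
        rw [← (hRd x hx).2, ← (hRd y hy).2, h]
    · refine ⟨y, Finset.mem_compl.2 hy, ?_⟩
      have := hG.pos_dist_of_ne hxy
      rw [G.dist_self]
      omega
  · refine ⟨x, Finset.mem_compl.2 hx, ?_⟩
    have := hG.pos_dist_of_ne hxy.symm
    rw [G.dist_self]
    omega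
end

section
/- If G is a finite simple connected graph whose girth g satisfies g ≥ 5, then γ(G) ≥ δ(G), where δ(G) is the minimum degree of G. -/
open SimpleGraph Finset

variable {V : Type*}

lemma no_triangle_aux (G : SimpleGraph V) (hg : 5 ≤ G.egirth) {a b c : V}
    (hab : G.Adj a b) (hbc : G.Adj b c) (hca : G.Adj c a) : False := by
  have hc : (Walk.cons hab (Walk.cons hbc (Walk.cons hca Walk.nil))).IsCycle := by
    have h1 := hab.ne
    have h2 := hbc.ne
    have h3 := hca.ne
    simp [Walk.cons_isCycle_iff, Walk.cons_isPath_iff]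
    grind
  have h := (le_egirth.1 hg) _ _ hc
  simp only [Walk.length_cons, Walk.length_nil] at h
  norm_cast at h

lemma no_square_aux (G : SimpleGraph V) (hg : 5 ≤ G.egirth) {a b c d : V}
    (hab : G.Adj a b) (hbc : G.Adj b c) (hcd : G.Adj c d) (hda : G.Adj d a)
    (hac : a ≠ c) (hbd : b ≠ d) : False := by
  have hc : (Walk.cons hab (Walk.cons hbc (Walk.cons hcd (Walk.cons hda Walk.nil)))).IsCycle := by
    have h1 := hab.ne
    have h2 := hbc.ne
    have h3 := hcd.ne
    have h4 := hda.ne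
    simp [Walk.cons_isCycle_iff, Walk.cons_isPath_iff]
    grind
  have h := (le_egirth.1 hg) _ _ hc
  simp only [Walk.length_cons, Walk.length_nil] at h
  norm_cast at h

/-- If `G` is connected with girth at least `5`, then `γ(G) ≥ δ(G)`. -/
theorem minDegree_le_dominationNumber_of_five_le_girth [Fintype V]
    (G : SimpleGraph V) [DecidableRel G.Adj] (hG : G.Connected) (hg : 5 ≤ G.egirth) :
    G.minDegree ≤ dominationNumber G := by
  classical
  have hne : {k | ∃ Γ : Finset V, IsDominatingSet G Γ ∧ Γ.card = k}.Nonempty :=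
    ⟨_, Finset.univ, fun v hv => absurd (Finset.mem_univ v) hv, rfl⟩
  obtain ⟨Γ, hΓ, hcard⟩ := Nat.sInf_mem hne
  change Γ.card = dominationNumber G at hcard
  rw [← hcard]
  obtain ⟨v₀⟩ := hG.nonempty
  by_cases hall : ∀ v, v ∈ Γ
  · rw [Finset.eq_univ_iff_forall.2 hall]
    exact (G.minDegree_le_degree v₀).trans (Finset.card_le_univ _)
  · push Not at hall
    obtain ⟨v, hv⟩ := hall
    refine (G.minDegree_le_degree v).trans ?_
    choose! f hf hadj using hΓ
    rw [← G.card_neighborFinset_eq_degree]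
    refine Finset.card_le_card_of_injOn (fun u => if u ∈ Γ then u else f u) ?_ ?_
    · intro u _
      by_cases h : u ∈ Γ
      · simpa [h] using h
      · simpa [h] using hf u h
    · intro a ha b hb hab
      have ha' : G.Adj v a := by simpa using ha
      have hb' : G.Adj v b := by simpa using hb
      by_contra hne
      by_cases h1 : a ∈ Γ <;> by_cases h2 : b ∈ Γ <;> simp only [h1, h2, if_true, if_false] at hab
      · exact hne hab
      · have h := hadj b h2
        rw [← hab] at h
        exact no_triangle_aux G hg ha' h.symm hb'.symm
      · have h := hadj a h1
        rw [hab] at h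
        exact no_triangle_aux G hg ha' h hb'.symm
      · have h3 := hadj a h1
        have h4 := hadj b h2
        rw [← hab] at h4
        have h5 : v ≠ f a := fun e => hv (e ▸ hf a h1)
        exact no_square_aux G hg ha' h3 h4.symm hb'.symm h5 hne
end

section
/- If G is a finite simple connected graph whose girth g satisfies g ≥ 6, then γ(G) ≥ 2(δ(G) − 1), where δ(G) is the minimum degree of G. -/
open SimpleGraph Finset

variable {V : Type*}

theorem no_three {G : SimpleGraph V} (hg : 6 ≤ G.egirth) {a b c : V}
    (h1 : G.Adj a b) (h2 : G.Adj b c) (h3 : G.Adj c a) : False := by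
  have hc : (Walk.cons h1 (Walk.cons h2 (Walk.cons h3 Walk.nil))).IsCycle := by
    have := h1.ne; have := h2.ne; have := h3.ne
    simp [Walk.cons_isCycle_iff]
    grind
  have := (le_egirth.1 hg) _ _ hc
  simp at this
  exact absurd this (by decide)

theorem no_four {G : SimpleGraph V} (hg : 6 ≤ G.egirth) {a b c d : V}
    (h1 : G.Adj a b) (h2 : G.Adj b c) (h3 : G.Adj c d) (h4 : G.Adj d a)
    (hac : a ≠ c) (hbd : b ≠ d) : False := by
  have hc : (Walk.cons h1 (Walk.cons h2 (Walk.cons h3 (Walk.cons h4 Walk.nil)))).IsCycle := by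
    have := h1.ne; have := h2.ne; have := h3.ne; have := h4.ne
    simp [Walk.cons_isCycle_iff]
    grind
  have := (le_egirth.1 hg) _ _ hc
  simp at this
  exact absurd this (by decide)

theorem no_five {G : SimpleGraph V} (hg : 6 ≤ G.egirth) {a b c d e : V}
    (h1 : G.Adj a b) (h2 : G.Adj b c) (h3 : G.Adj c d) (h4 : G.Adj d e) (h5 : G.Adj e a)
    (hac : a ≠ c) (had : a ≠ d) (hbd : b ≠ d) (hbe : b ≠ e) (hce : c ≠ e) : False := by
  have hc : (Walk.cons h1 (Walk.cons h2 (Walk.cons h3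
      (Walk.cons h4 (Walk.cons h5 Walk.nil))))).IsCycle := by
    have := h1.ne; have := h2.ne; have := h3.ne; have := h4.ne; have := h5.ne
    simp [Walk.cons_isCycle_iff]
    grind
  have := (le_egirth.1 hg) _ _ hc
  simp at this
  exact absurd this (by decide)

/-- Two neighbors of `u` are not dominated by the same vertex other than `u`. -/
theorem inj_same {G : SimpleGraph V} (hg : 6 ≤ G.egirth) {u w w' z : V}
    (hw : G.Adj u w) (hw' : G.Adj u w') (hz : z = w ∨ G.Adj w z) (hz' : z = w' ∨ G.Adj w' z)
    (hzu : z ≠ u) : w = w' := by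
  by_contra hne
  rcases hz with rfl | hz <;> rcases hz' with rfl | hz'
  · exact hne rfl
  · exact no_three hg hw hz'.symm hw'.symm
  · exact no_three hg hw hz hw'.symm
  · exact no_four hg hw hz hz'.symm hw'.symm hzu.symm hne

theorem inj_diff {G : SimpleGraph V} (hg : 6 ≤ G.egirth) {u v w w' z : V} (huv : G.Adj u v)
    (hw : G.Adj u w) (hw' : G.Adj v w') (hwv : w ≠ v) (hwu : w' ≠ u)
    (hz : z = w ∨ G.Adj w z) (hz' : z = w' ∨ G.Adj w' z)
    (hzu : z ≠ u) (hzv : z ≠ v) : False := by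
  by_cases hne : w = w'
  · subst hne
    exact no_three hg hw hw'.symm huv.symm
  rcases hz with rfl | hz <;> rcases hz' with rfl | hz'
  · exact hne rfl
  · exact no_four hg hw hz'.symm hw'.symm huv.symm hwu.symm hwv
  · exact no_four hg hw hz hw'.symm huv.symm hwu.symm hwv
  · exact no_five hg hw hz hz'.symm hw'.symm huv.symm hzu.symm hwu.symm hne hwv hzv

theorem card_bound [Fintype V] {G : SimpleGraph V} [DecidableRel G.Adj] (hg : 6 ≤ G.egirth)
    {u v : V} (huv : G.Adj u v) (Γ : Finset V)
    (hu : ∀ w, G.Adj u w → w ≠ v → ∃ z ∈ Γ, (z = w ∨ G.Adj w z) ∧ z ≠ u)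
    (hv : ∀ w, G.Adj v w → w ≠ u → ∃ z ∈ Γ, (z = w ∨ G.Adj w z) ∧ z ≠ v) :
    2 * (G.minDegree - 1) ≤ Γ.card := by
  classical
  set A := (G.neighborFinset u).erase v with hA
  set B := (G.neighborFinset v).erase u with hB
  have hdisj : Disjoint A B := by
    rw [Finset.disjoint_left]
    intro w h1 h2
    simp [hA, hB] at h1 h2
    exact no_three hg h1.2 h2.2.symm huv.symm
  have cA : G.minDegree - 1 ≤ A.card := by
    rw [hA, Finset.card_erase_of_mem (by simpa using huv), card_neighborFinset_eq_degree]
    have := G.minDegree_le_degree u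
    omega
  have cB : G.minDegree - 1 ≤ B.card := by
    rw [hB, Finset.card_erase_of_mem (by simpa using huv.symm), card_neighborFinset_eq_degree]
    have := G.minDegree_le_degree v
    omega
  have key : ∀ w ∈ A ∪ B, ∃ z ∈ Γ, (z = w ∨ G.Adj w z) ∧ z ≠ u ∧ z ≠ v := by
    intro w hw
    simp [hA, hB] at hw
    rcases hw with ⟨h1, h2⟩ | ⟨h1, h2⟩
    · obtain ⟨z, hz, h, h'⟩ := hu w h2 h1
      refine ⟨z, hz, h, h', ?_⟩
      rintro rfl
      rcases h with h | h
      · exact h1 h.symm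
      · exact no_three hg h2 h huv.symm
    · obtain ⟨z, hz, h, h'⟩ := hv w h2 h1
      refine ⟨z, hz, h, ?_, h'⟩
      rintro rfl
      rcases h with h | h
      · exact h1 h.symm
      · exact no_three hg h2 h huv
  choose! d hd1 hd2 hdu hdv using key
  have hle : (A ∪ B).card ≤ Γ.card := by
    refine Finset.card_le_card_of_injOn d hd1 ?_
    intro w hw w' hw' heq
    have a1 := hd2 w hw
    have a2 := hd2 w' hw'
    have a3 := hdu w hw
    have a4 := hdv w hw
    rw [← heq] at a2
    simp [hA, hB] at hw hw'
    rcases hw with ⟨h2, h1⟩ | ⟨h2, h1⟩ <;> rcases hw' with ⟨h2', h1'⟩ | ⟨h2', h1'⟩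
    · exact inj_same hg h2 h2' a1 a2 a3
    · exact (inj_diff hg huv h2 h2' h1 h1' a1 a2 a3 a4).elim
    · exact (inj_diff hg huv h2' h2 h1' h1 a2 a1 a3 a4).elim
    · exact inj_same hg h2 h2' a1 a2 a4
  rw [Finset.card_union_of_disjoint hdisj] at hle
  omega

theorem bound_of_dominating [Fintype V] {G : SimpleGraph V} [DecidableRel G.Adj]
    (hG : G.Connected) (hg : 6 ≤ G.egirth) (Γ : Finset V) (hΓ : IsDominatingSet G Γ) :
    2 * (G.minDegree - 1) ≤ Γ.card := by
  classical
  by_cases hδ : G.minDegree ≤ 1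
  · have : G.minDegree - 1 = 0 := by omega
    simp [this]
  push Not at hδ
  by_cases hE : ∃ u v, G.Adj u v ∧ u ∉ Γ ∧ v ∉ Γ
  · obtain ⟨u, v, huv, hu, hv⟩ := hE
    have gen : ∀ x, x ∉ Γ → ∀ w, ∃ z ∈ Γ, (z = w ∨ G.Adj w z) ∧ z ≠ x := by
      intro x hx w
      by_cases hw : w ∈ Γ
      · exact ⟨w, hw, Or.inl rfl, fun h => hx (h ▸ hw)⟩
      · obtain ⟨z, hz, h⟩ := hΓ w hw
        exact ⟨z, hz, Or.inr h, fun h => hx (h ▸ hz)⟩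
    exact card_bound hg huv Γ (fun w _ _ => gen u hu w) (fun w _ _ => gen v hv w)
  · push Not at hE
    have gen : ∀ x w, G.Adj x w → ∃ z ∈ Γ, (z = w ∨ G.Adj w z) ∧ z ≠ x := by
      intro x w hxw
      by_cases hw : w ∈ Γ
      · exact ⟨w, hw, Or.inl rfl, hxw.ne'⟩
      · have h1 : 1 < (G.neighborFinset w).card := by
          rw [card_neighborFinset_eq_degree]
          exact hδ.trans_le (G.minDegree_le_degree w)
        obtain ⟨z, hz, hzx⟩ := Finset.exists_mem_ne h1 x
        rw [mem_neighborFinset] at hz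
        refine ⟨z, ?_, Or.inr hz, hzx⟩
        exact hE w z hz hw
    obtain ⟨u⟩ := hG.nonempty
    have h0 : 0 < G.degree u := by
      have := G.minDegree_le_degree u
      omega
    obtain ⟨v, huv⟩ := (G.degree_pos_iff_exists_adj u).1 h0
    exact card_bound hg huv Γ (fun w h _ => gen u w h) (fun w h _ => gen v w h)

/-- If `G` is connected with girth at least `6`, then `γ(G) ≥ 2(δ(G) - 1)`. -/
theorem two_mul_minDegree_sub_one_le_dominationNumber_of_six_le_girth [Fintype V]
    (G : SimpleGraph V) [DecidableRel G.Adj] (hG : G.Connected) (hg : 6 ≤ G.egirth) :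
    2 * (G.minDegree - 1) ≤ dominationNumber G := by
  have hne : {k | ∃ Γ : Finset V, IsDominatingSet G Γ ∧ Γ.card = k}.Nonempty :=
    ⟨_, Finset.univ, fun v hv => absurd (Finset.mem_univ v) hv, rfl⟩
  obtain ⟨Γ, hΓ, hc⟩ := Nat.sInf_mem hne
  unfold dominationNumber
  rw [← hc]
  exact bound_of_dominating hG hg Γ hΓ
end

section
/- Let G be a finite simple graph of order n with degree sequence (d_1, d_2, …, d_n) where d_i ≥ d_{i+1} for all i. Then γ(G) ≥ min{k : k + (d_1 + d_2 + ⋯ + d_k) ≥ n}. -/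
open SimpleGraph Finset

variable {V : Type*}

/-- The sum of a nonincreasing sequence over a finite index set is at most the sum of its
first terms. -/
theorem sum_le_sum_range_card_of_sorted (n : ℕ) (d : ℕ → ℕ)
    (hd : ∀ i j : ℕ, i ≤ j → j < n → d j ≤ d i) (S : Finset ℕ) :
    (∀ i ∈ S, i < n) → ∑ i ∈ S, d i ≤ ∑ i ∈ Finset.range S.card, d i := by
  induction S using Finset.induction_on_max with
  | empty => simp
  | insert a S ha ih =>
    intro h
    have hna : a ∉ S := fun hm => lt_irrefl _ (ha a hm)
    rw [Finset.sum_insert hna, Finset.card_insert_of_notMem hna, Finset.sum_range_succ, add_comm]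
    have hc : S.card ≤ a := by
      have := Finset.card_le_card (s := S) (t := Finset.range a)
        (fun x hx => Finset.mem_range.2 (ha x hx))
      simpa using this
    exact add_le_add (ih fun i hi => h i (Finset.mem_insert_of_mem hi))
      (hd _ _ hc (h a (Finset.mem_insert_self _ _)))

/-- If `G` has order `n` and nonincreasing degree sequence `d₁ ≥ d₂ ≥ ⋯ ≥ dₙ`,
then `γ(G) ≥ min {k : k + (d₁ + ⋯ + d_k) ≥ n}`. (Here `d 0, d 1, …, d (n-1)` lists the
degrees of `G` in nonincreasing order.) -/
theorem sInf_le_dominationNumber_of_degree_sequence [Fintype V]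
    (G : SimpleGraph V) [DecidableRel G.Adj] (d : ℕ → ℕ)
    (hsorted : ∀ i j : ℕ, i ≤ j → j < Fintype.card V → d j ≤ d i)
    (hdeg : ∃ σ : Fin (Fintype.card V) ≃ V, ∀ i : Fin (Fintype.card V), d i = G.degree (σ i)) :
    sInf {k : ℕ | Fintype.card V ≤ k + ∑ i ∈ Finset.range k, d i} ≤ dominationNumber G := by
  classical
  obtain ⟨σ, hσ⟩ := hdeg
  have hne : {k | ∃ Γ : Finset V, IsDominatingSet G Γ ∧ Γ.card = k}.Nonempty :=
    ⟨_, Finset.univ, fun v hv => absurd (Finset.mem_univ v) hv, rfl⟩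
  obtain ⟨Γ, hΓ, hcard⟩ := Nat.sInf_mem hne
  apply Nat.sInf_le
  change Fintype.card V ≤ dominationNumber G + ∑ i ∈ Finset.range (dominationNumber G), d i
  have hcard' : Γ.card = dominationNumber G := hcard
  rw [← hcard']
  have hcover : (Finset.univ : Finset V) ⊆ Γ ∪ Γ.biUnion (fun u => G.neighborFinset u) := by
    intro v _
    by_cases hv : v ∈ Γ
    · exact Finset.mem_union_left _ hv
    · obtain ⟨u, hu, huv⟩ := hΓ v hv
      exact Finset.mem_union_right _
        (Finset.mem_biUnion.2 ⟨u, hu, (G.mem_neighborFinset u v).2 huv.symm⟩)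
  have h1 : Fintype.card V ≤ Γ.card + ∑ u ∈ Γ, G.degree u :=
    (Finset.card_le_card hcover).trans
      ((Finset.card_union_le _ _).trans (Nat.add_le_add_left Finset.card_biUnion_le _))
  have hinj : Function.Injective (fun u : V => ((σ.symm u : Fin _) : ℕ)) :=
    Fin.val_injective.comp σ.symm.injective
  have h2 := sum_le_sum_range_card_of_sorted (Fintype.card V) d hsorted
    (Γ.image fun u : V => ((σ.symm u : Fin _) : ℕ)) (by
      intro i hi
      obtain ⟨u, _, rfl⟩ := Finset.mem_image.1 hi
      exact (σ.symm u).isLt)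
  rw [Finset.card_image_of_injective _ hinj, Finset.sum_image hinj.injOn] at h2
  have h3 : ∑ u ∈ Γ, d (σ.symm u : Fin _) = ∑ u ∈ Γ, G.degree u :=
    Finset.sum_congr rfl fun u _ => by rw [hσ, Equiv.apply_symm_apply]
  omega
end

section
/- If G is a finite simple connected graph with minimum degree δ(G) ≥ 2 and girth g ≥ 7, then γ(G) ≥ Δ(G), where Δ(G) is the maximum degree of G. -/
open SimpleGraph Finset

variable {V : Type*}

theorem aux_c3 {V : Type*} {G : SimpleGraph V} (hg : 7 ≤ G.egirth) {a b c : V}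
    (h1 : G.Adj a b) (h2 : G.Adj b c) (h3 : G.Adj c a) : False := by
  have hc : (Walk.cons h1 (.cons h2 (.cons h3 .nil))).IsCycle := by
    have := h1.ne; have := h2.ne; have := h3.ne
    simp [Walk.cons_isCycle_iff]; grind
  have := le_egirth.1 hg _ _ hc
  simp only [Walk.length_cons, Walk.length_nil] at this
  exact absurd this (by norm_num)

theorem aux_c4 {V : Type*} {G : SimpleGraph V} (hg : 7 ≤ G.egirth) {a b c d : V}
    (h1 : G.Adj a b) (h2 : G.Adj b c) (h3 : G.Adj c d) (h4 : G.Adj d a)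
    (hac : a ≠ c) (hbd : b ≠ d) : False := by
  have hc : (Walk.cons h1 (.cons h2 (.cons h3 (.cons h4 .nil)))).IsCycle := by
    have := h1.ne; have := h2.ne; have := h3.ne; have := h4.ne
    simp [Walk.cons_isCycle_iff]; grind
  have := le_egirth.1 hg _ _ hc
  simp only [Walk.length_cons, Walk.length_nil] at this
  exact absurd this (by norm_num)

theorem aux_c5 {V : Type*} {G : SimpleGraph V} (hg : 7 ≤ G.egirth) {a b c d e : V}
    (h1 : G.Adj a b) (h2 : G.Adj b c) (h3 : G.Adj c d) (h4 : G.Adj d e) (h5 : G.Adj e a) :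
    False := by
  have e1 : a ≠ c := by rintro rfl; exact aux_c3 hg h3 h4 h5
  have e2 : b ≠ d := by rintro rfl; exact aux_c3 hg h4 h5 h1
  have e3 : c ≠ e := by rintro rfl; exact aux_c3 hg h5 h1 h2
  have e4 : d ≠ a := by rintro rfl; exact aux_c3 hg h1 h2 h3
  have e5 : e ≠ b := by rintro rfl; exact aux_c3 hg h2 h3 h4
  have hc : (Walk.cons h1 (.cons h2 (.cons h3 (.cons h4 (.cons h5 .nil))))).IsCycle := by
    have := h1.ne; have := h2.ne; have := h3.ne; have := h4.ne; have := h5.ne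
    simp [Walk.cons_isCycle_iff]; grind
  have := le_egirth.1 hg _ _ hc
  simp only [Walk.length_cons, Walk.length_nil] at this
  exact absurd this (by norm_num)

theorem aux_c6 {V : Type*} {G : SimpleGraph V} (hg : 7 ≤ G.egirth) {a b c d e f : V}
    (h1 : G.Adj a b) (h2 : G.Adj b c) (h3 : G.Adj c d) (h4 : G.Adj d e) (h5 : G.Adj e f)
    (h6 : G.Adj f a) (e1 : a ≠ c) (e2 : b ≠ d) (e3 : c ≠ e) (e4 : d ≠ f) (e5 : e ≠ a)
    (e6 : f ≠ b) : False := by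
  have t1 : a ≠ d := by rintro rfl; exact aux_c3 hg h1 h2 h3
  have t2 : b ≠ e := by rintro rfl; exact aux_c3 hg h2 h3 h4
  have t3 : c ≠ f := by rintro rfl; exact aux_c3 hg h3 h4 h5
  have hc : (Walk.cons h1 (.cons h2 (.cons h3 (.cons h4 (.cons h5 (.cons h6 .nil)))))).IsCycle := by
    have := h1.ne; have := h2.ne; have := h3.ne; have := h4.ne; have := h5.ne; have := h6.ne
    simp [Walk.cons_isCycle_iff]; grind
  have := le_egirth.1 hg _ _ hc
  simp only [Walk.length_cons, Walk.length_nil] at this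
  exact absurd this (by norm_num)

/-- If `G` is connected with `δ(G) ≥ 2` and girth at least `7`, then
`γ(G) ≥ Δ(G)`. -/
theorem maxDegree_le_dominationNumber_of_two_le_minDegree_of_seven_le_girth [Fintype V]
    (G : SimpleGraph V) [DecidableRel G.Adj] (hG : G.Connected)
    (hδ : 2 ≤ G.minDegree) (hg : 7 ≤ G.egirth) :
    G.maxDegree ≤ dominationNumber G := by
  classical
  have : Nonempty V := hG.nonempty
  unfold dominationNumber
  refine le_csInf ⟨_, Finset.univ, fun v hv => absurd (Finset.mem_univ v) hv, rfl⟩ ?_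
  rintro k ⟨Γ, hΓ, rfl⟩
  obtain ⟨v, hv⟩ := G.exists_maximal_degree_vertex
  rw [hv, ← G.card_neighborFinset_eq_degree]
  have hn : ∀ u, ∃ w, G.Adj u w ∧ w ≠ v := by
    intro u
    have h2 : 1 < (G.neighborFinset u).card := by
      rw [G.card_neighborFinset_eq_degree]
      exact lt_of_lt_of_le one_lt_two (hδ.trans (G.minDegree_le_degree u))
    obtain ⟨w, hw, hwv⟩ := Finset.exists_mem_ne h2 v
    exact ⟨w, by simpa using hw, hwv⟩
  choose n hn1 hn2 using hn
  have hd : ∀ u, ∃ w ∈ Γ, w = u ∨ G.Adj u w := by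
    intro u
    by_cases h : u ∈ Γ
    · exact ⟨u, h, Or.inl rfl⟩
    · obtain ⟨w, hw, hw'⟩ := hΓ u h
      exact ⟨w, hw, Or.inr hw'⟩
  choose d hd1 hd2 using hd
  refine Finset.card_le_card_of_injOn (fun u => d (n u)) (fun u _ => hd1 _) ?_
  intro x hx y hy hxy
  have hx : G.Adj v x := by simpa using hx
  have hy : G.Adj v y := by simpa using hy
  simp only at hxy
  by_contra hne
  have hnn : n x ≠ n y := fun h =>
    aux_c4 hg hx (hn1 x) (h ▸ (hn1 y).symm) hy.symm (hn2 x).symm hne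
  have ax := hd2 (n x)
  have ay := hd2 (n y)
  rw [← hxy] at ay
  generalize d (n x) = z at ax ay
  rcases ax with rfl | ax <;> rcases ay with h | ay
  · exact hnn h
  · exact aux_c5 hg hx (hn1 x) ay.symm (hn1 y).symm hy.symm
  · subst h
    exact aux_c5 hg hx (hn1 x) ax (hn1 y).symm hy.symm
  · have t1 : x ≠ z := by
      rintro rfl
      exact aux_c4 hg hx ay.symm (hn1 y).symm hy.symm (hn2 y).symm hne
    have t2 : z ≠ y := by
      rintro rfl
      exact aux_c4 hg hx (hn1 x) ax hy.symm (hn2 x).symm hne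
    exact aux_c6 hg hx (hn1 x) ax ay.symm (hn1 y).symm hy.symm (hn2 x).symm t1 hnn t2
      (hn2 y) (Ne.symm hne)
end

section
/- Let G be a finite simple connected graph of order n ≥ 2 and let μ_n ≥ μ_{n−1} ≥ ⋯ ≥ μ_1 be the eigenvalues of the Laplacian matrix of G. Then γ(G) ≥ n / μ_n. -/
open SimpleGraph Finset

variable {V : Type*}

theorem lap_rayleigh_aux {W : Type*} [Fintype W] [DecidableEq W] (A : Matrix W W ℝ)
    (hA : A.IsHermitian) (μ : ℝ) (hmax : ∀ i, hA.eigenvalues i ≤ μ) (x : W → ℝ) :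
    x ⬝ᵥ (A.mulVec x) ≤ μ * (x ⬝ᵥ x) := by
  have hB : ((algebraMap ℝ (Matrix W W ℝ) μ) - A).IsHermitian := by
    refine Matrix.IsHermitian.sub ?_ hA
    rw [Matrix.algebraMap_eq_diagonal]
    exact Matrix.isHermitian_diagonal _
  have hP : ((algebraMap ℝ (Matrix W W ℝ) μ) - A).PosSemidef := by
    rw [hB.posSemidef_iff_eigenvalues_nonneg]
    intro i
    have h1 := hB.eigenvalues_mem_spectrum_real i
    rw [← spectrum.singleton_sub_eq, hA.spectrum_real_eq_range_eigenvalues] at h1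
    obtain ⟨a, ha, b, ⟨j, rfl⟩, hab⟩ := h1
    have := hmax j
    simp only [Set.mem_singleton_iff] at ha
    subst ha
    simp only at hab
    simp only [Pi.zero_apply]
    linarith
  have h2 := hP.dotProduct_mulVec_nonneg x
  rw [Matrix.sub_mulVec, dotProduct_sub, Algebra.algebraMap_eq_smul_one, Matrix.smul_mulVec,
    Matrix.one_mulVec, dotProduct_smul, star_trivial, smul_eq_mul] at h2
  linarith

theorem dominating_bound_aux
    [Fintype V] [DecidableEq V] (G : SimpleGraph V) [DecidableRel G.Adj]
    (hL : (G.lapMatrix ℝ).IsHermitian) (μ : ℝ)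
    (hmax : ∀ i : V, hL.eigenvalues i ≤ μ) (Γ : Finset V) (hΓ : IsDominatingSet G Γ)
    (hlt : Γ.card < Fintype.card V) :
    (Fintype.card V : ℝ) ≤ μ * Γ.card := by
  set n : ℝ := (Fintype.card V : ℝ) with hn
  set k : ℝ := (Γ.card : ℝ) with hk
  have hkn : k < n := by rw [hn, hk]; exact_mod_cast hlt
  have hk0 : 0 ≤ k := by rw [hk]; positivity
  have hc : ((Γᶜ.card : ℕ) : ℝ) = n - k := by
    rw [Finset.card_compl, Nat.cast_sub hlt.le]
  let x : V → ℝ := fun i => if i ∈ Γ then n - k else -k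
  have hR := lap_rayleigh_aux _ hL μ hmax x
  have hxx : x ⬝ᵥ x = k * (n - k) * n := by
    have : x ⬝ᵥ x = ∑ i, if i ∈ Γ then (n - k)^2 else k^2 := by
      refine Finset.sum_congr rfl fun i _ => ?_
      simp only [x]; split_ifs <;> ring
    rw [this, ← Finset.sum_add_sum_compl Γ,
      Finset.sum_congr rfl (g := fun _ => (n - k)^2) (fun i hi => if_pos hi),
      Finset.sum_congr (s₁ := Γᶜ) rfl (g := fun _ => k^2)
        (fun i hi => if_neg (Finset.mem_compl.1 hi))]
    simp only [Finset.sum_const, nsmul_eq_mul, hc]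
    rw [← hk]; ring
  have hq := G.lapMatrix_toLinearMap₂' (R := ℝ) x
  rw [Matrix.toLinearMap₂'_apply'] at hq
  let g : V → V → ℝ := fun i j => if i ∉ Γ ∧ j ∈ Γ ∧ G.Adj i j then n^2 else 0
  have hg : ∑ i, ∑ j, (g i j + g j i) ≤
      ∑ i, ∑ j, if G.Adj i j then (x i - x j)^2 else 0 := by
    refine Finset.sum_le_sum fun i _ => Finset.sum_le_sum fun j _ => ?_
    simp only [g, x, G.adj_comm j i]
    by_cases h1 : i ∈ Γ <;> by_cases h2 : j ∈ Γ <;> by_cases h3 : G.Adj i j <;> simp [h1, h2, h3]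
    nlinarith
  have hg0 : ∀ i j, 0 ≤ g i j := fun i j => by simp only [g]; split_ifs <;> positivity
  have hs : n^2 * (n - k) ≤ ∑ i, ∑ j, g i j := by
    calc n^2 * (n - k) = ∑ i ∈ Γᶜ, n^2 := by
          rw [Finset.sum_const, nsmul_eq_mul, hc]; ring
      _ ≤ ∑ i ∈ Γᶜ, ∑ j, g i j := by
          refine Finset.sum_le_sum fun i hi => ?_
          have hi' := Finset.mem_compl.1 hi
          obtain ⟨u, hu, hadj⟩ := hΓ i hi'
          have : g i u = n^2 := if_pos ⟨hi', hu, hadj⟩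
          rw [← this]
          exact Finset.single_le_sum (f := g i) (fun j _ => hg0 i j) (Finset.mem_univ u)
      _ ≤ _ := Finset.sum_le_sum_of_subset_of_nonneg (Finset.subset_univ _)
          fun i _ _ => Finset.sum_nonneg fun j _ => hg0 i j
  have hs2 : ∑ i, ∑ j, (g i j + g j i) = 2 * ∑ i, ∑ j, g i j := by
    simp only [Finset.sum_add_distrib]
    rw [Finset.sum_comm (f := fun i j => g j i)]; ring
  have hfin : (n * (n - k)) * n ≤ (n * (n - k)) * (μ * k) := by
    rw [hxx] at hR
    linarith
  have hpos : 0 < n * (n - k) := mul_pos (by linarith) (by linarith)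
  exact le_of_mul_le_mul_left hfin hpos

/-- If `G` is connected of order `n ≥ 2` and `μ` is the largest eigenvalue of
the Laplacian matrix of `G`, then `γ(G) ≥ n / μ`. -/
theorem card_div_largest_lapMatrix_eigenvalue_le_dominationNumber
    [Fintype V] [DecidableEq V] (G : SimpleGraph V) [DecidableRel G.Adj]
    (hG : G.Connected) (hn : 2 ≤ Fintype.card V)
    (hL : (G.lapMatrix ℝ).IsHermitian) (μ : ℝ)
    (hmem : ∃ i : V, hL.eigenvalues i = μ) (hmax : ∀ i : V, hL.eigenvalues i ≤ μ) :
    (Fintype.card V : ℝ) / μ ≤ (dominationNumber G : ℝ) := by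
  haveI : Nontrivial V := Fintype.one_lt_card_iff_nontrivial.1 hn
  obtain ⟨v⟩ := hG.nonempty
  obtain ⟨w, hw⟩ := hG.preconnected.exists_adj_of_nontrivial v
  have hd : IsDominatingSet G ({v}ᶜ : Finset V) := by
    intro a ha
    have : a = v := by simpa using ha
    subst this
    exact ⟨w, by simpa using hw.ne', hw⟩
  have hle : dominationNumber G ≤ ({v}ᶜ : Finset V).card := Nat.sInf_le ⟨_, hd, rfl⟩
  rw [Finset.card_compl, Finset.card_singleton] at hle
  obtain ⟨Γ, hΓ, hc⟩ : dominationNumber G ∈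
      {k | ∃ Γ : Finset V, IsDominatingSet G Γ ∧ Γ.card = k} :=
    Nat.sInf_mem ⟨_, _, hd, rfl⟩
  have hb := dominating_bound_aux G hL μ hmax Γ hΓ (by omega)
  rw [hc] at hb
  have hn' : (2 : ℝ) ≤ Fintype.card V := by exact_mod_cast hn
  have hμ : 0 < μ := by
    by_contra h
    have : μ * (dominationNumber G : ℝ) ≤ 0 :=
      mul_nonpos_of_nonpos_of_nonneg (not_lt.1 h) (Nat.cast_nonneg _)
    linarith
  rw [div_le_iff₀ hμ]
  linarith
end

section
/- If G is a finite simple connected graph of order n whose girth g satisfies g ≥ 6, then β(G) ≤ n − 2δ(G) + 2, where δ(G) is the minimum degree of G. -/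
open SimpleGraph Finset

variable {V : Type*}

theorem no_three_cycle (G : SimpleGraph V) (hg : 6 ≤ G.egirth) {a b c : V}
    (hab : G.Adj a b) (hbc : G.Adj b c) (hca : G.Adj c a) : False := by
  have hc : (Walk.cons hab (Walk.cons hbc (Walk.cons hca Walk.nil))).IsCycle := by
    have h1 := hab.ne
    have h2 := hbc.ne
    have h3 := hca.ne
    simp [Walk.cons_isCycle_iff, Walk.cons_isPath_iff]
    grind
  have h := le_egirth.1 hg _ _ hc
  simp only [Walk.length_cons, Walk.length_nil] at h
  norm_cast at h

theorem no_four_cycle (G : SimpleGraph V) (hg : 6 ≤ G.egirth) {a b c d : V}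
    (hab : G.Adj a b) (hbc : G.Adj b c) (hcd : G.Adj c d) (hda : G.Adj d a)
    (hac : a ≠ c) (hbd : b ≠ d) : False := by
  have hc : (Walk.cons hab (Walk.cons hbc (Walk.cons hcd (Walk.cons hda Walk.nil)))).IsCycle := by
    have h1 := hab.ne
    have h2 := hbc.ne
    have h3 := hcd.ne
    have h4 := hda.ne
    simp [Walk.cons_isCycle_iff, Walk.cons_isPath_iff]
    grind
  have h := le_egirth.1 hg _ _ hc
  simp only [Walk.length_cons, Walk.length_nil] at h
  norm_cast at h

theorem metricDimension_le_of_resolving [Fintype V] (G : SimpleGraph V) (W : Finset V)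
    (h : IsResolvingSet G W) : metricDimension G ≤ W.card :=
  Nat.sInf_le ⟨W, h, rfl⟩

/-- Two distinct neighbours of `u`, the first having a further neighbour in `W`. -/
theorem resolve_same_side (G : SimpleGraph V) (hg : 6 ≤ G.egirth) {u x y w : V}
    (hx : G.Adj u x) (hy : G.Adj u y) (hxy : x ≠ y) (hw : G.Adj x w) (hwu : w ≠ u) :
    G.dist x w ≠ G.dist y w := by
  intro h
  rw [dist_eq_one_iff_adj.2 hw] at h
  exact no_four_cycle G hg hx hw (dist_eq_one_iff_adj.1 h.symm).symm hy.symm hwu.symm hxy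

/-- If `G` is connected of order `n` with girth at least `6`, then
`β(G) ≤ n - 2δ(G) + 2`. -/
theorem metricDimension_le_card_sub_two_mul_minDegree_add_two_of_six_le_girth [Fintype V]
    (G : SimpleGraph V) [DecidableRel G.Adj] (hG : G.Connected) (hg : 6 ≤ G.egirth) :
    (metricDimension G : ℤ) ≤ (Fintype.card V : ℤ) - 2 * (G.minDegree : ℤ) + 2 := by
  classical
  by_cases hδ : G.minDegree ≤ 1
  · have h := metricDimension_le_of_resolving G univ (fun u v huv => ⟨u, mem_univ _, by
      rw [dist_self]
      exact fun h => huv (hG.dist_eq_zero_iff.1 h.symm).symm⟩)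
    rw [card_univ] at h
    omega
  have hdeg : ∀ x, 2 ≤ (G.neighborFinset x).card := fun x => by
    have := G.minDegree_le_degree x
    rw [card_neighborFinset_eq_degree]
    omega
  obtain ⟨u⟩ := hG.nonempty
  obtain ⟨v, hv⟩ : (G.neighborFinset u).Nonempty := card_pos.1 (by have := hdeg u; omega)
  have huv : G.Adj u v := by simpa using hv
  have other : ∀ x z, ∃ w, G.Adj x w ∧ w ≠ z := fun x z => by
    obtain ⟨w, hw, hne⟩ := exists_mem_ne (hdeg x) z
    exact ⟨w, by simpa using hw, hne⟩
  set A := (G.neighborFinset u).erase v with hA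
  set B := (G.neighborFinset v).erase u with hB
  have memA : ∀ x, x ∈ A ↔ x ≠ v ∧ G.Adj u x := by simp [hA]
  have memB : ∀ x, x ∈ B ↔ x ≠ u ∧ G.Adj v x := by simp [hB]
  have hdisj : Disjoint A B := by
    rw [Finset.disjoint_left]
    intro x hx hx'
    rw [memA] at hx
    rw [memB] at hx'
    exact no_three_cycle G hg huv hx'.2 hx.2.symm
  have hres : IsResolvingSet G (A ∪ B)ᶜ := by
    have hcA : ∀ x ∈ A, ∀ w, G.Adj x w → w ∈ (A ∪ B)ᶜ := by
      intro x hx w hw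
      rw [memA] at hx
      simp only [mem_compl, mem_union, memA, memB]
      rintro (h | h)
      · exact no_three_cycle G hg hx.2 hw h.2.symm
      · exact no_four_cycle G hg hx.2 hw h.2.symm huv.symm h.1.symm hx.1
    have hcB : ∀ x ∈ B, ∀ w, G.Adj x w → w ∈ (A ∪ B)ᶜ := by
      intro x hx w hw
      rw [memB] at hx
      simp only [mem_compl, mem_union, memA, memB]
      rintro (h | h)
      · exact no_four_cycle G hg hx.2 hw h.2.symm huv h.1.symm hx.1
      · exact no_three_cycle G hg hx.2 hw h.2.symm
    have huW : u ∈ (A ∪ B)ᶜ := by simp [memA, memB]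
    have key : ∀ x ∈ A, ∀ y ∈ B, G.dist x u ≠ G.dist y u := by
      intro x hx y hy h
      rw [memA] at hx
      rw [memB] at hy
      rw [dist_eq_one_iff_adj.2 hx.2.symm] at h
      exact no_three_cycle G hg huv hy.2 (dist_eq_one_iff_adj.1 h.symm)
    intro x y hxy
    by_cases hx : x ∈ A ∪ B
    swap
    · exact ⟨x, by simpa using hx, by
        rw [dist_self]
        exact fun h => hxy (hG.dist_eq_zero_iff.1 h.symm).symm⟩
    by_cases hy : y ∈ A ∪ B
    swap
    · exact ⟨y, by simpa using hy, by
        rw [dist_self]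
        exact fun h => hxy (hG.dist_eq_zero_iff.1 h)⟩
    rcases mem_union.1 hx with hx | hx <;> rcases mem_union.1 hy with hy | hy
    · obtain ⟨w, hw, hne⟩ := other x u
      exact ⟨w, hcA x hx w hw,
        resolve_same_side G hg ((memA x).1 hx).2 ((memA y).1 hy).2 hxy hw hne⟩
    · exact ⟨u, huW, key x hx y hy⟩
    · exact ⟨u, huW, (key y hy x hx).symm⟩
    · obtain ⟨w, hw, hne⟩ := other x v
      exact ⟨w, hcB x hx w hw,
        resolve_same_side G hg ((memB x).1 hx).2 ((memB y).1 hy).2 hxy hw hne⟩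
  have h := metricDimension_le_of_resolving G _ hres
  have hcA : A.card = G.degree u - 1 := by
    rw [hA, card_erase_of_mem hv, card_neighborFinset_eq_degree]
  have hcB : B.card = G.degree v - 1 := by
    rw [hB, card_erase_of_mem (by simpa using huv.symm), card_neighborFinset_eq_degree]
  have h1 := card_add_card_compl (A ∪ B)
  rw [card_union_of_disjoint hdisj] at h1
  have h2 := G.minDegree_le_degree u
  have h3 := G.minDegree_le_degree v
  omega
end

section
/- For every finite simple connected graph G of order n, β(G) ≤ n − ⌈n / (1 + Δ(G))⌉, where Δ(G) is the maximum degree of G. -/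
open SimpleGraph Finset

variable {V : Type*}

open Classical in
/-- The vertices of `Γ` with no neighbor in `Γ`. -/
noncomputable def isolatedIn (G : SimpleGraph V) (Γ : Finset V) : Finset V :=
  Γ.filter (fun x => ∀ y ∈ Γ, ¬ G.Adj x y)

/-- Bollobás–Cockayne: a graph without isolated vertices has a dominating set in which every
vertex has an external private neighbor. -/
theorem exists_private_dominating [Fintype V] (G : SimpleGraph V)
    (hiso : ∀ u : V, ∃ v, G.Adj u v) :
    ∃ Γ : Finset V, IsDominatingSet G Γ ∧
      ∀ u ∈ Γ, ∃ p, p ∉ Γ ∧ G.Adj u p ∧ ∀ v ∈ Γ, G.Adj v p → v = u := by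
  classical
  obtain ⟨Γ, hΓ, hmin⟩ := Finset.exists_min_image
    (Finset.univ.filter (fun Γ : Finset V => IsDominatingSet G Γ))
    (fun Γ => toLex (Γ.card, (isolatedIn G Γ).card))
    ⟨Finset.univ, Finset.mem_filter.2 ⟨Finset.mem_univ _, fun v hv => absurd (Finset.mem_univ v) hv⟩⟩
  have hdom : IsDominatingSet G Γ := by simpa using hΓ
  have hmin' : ∀ Γ' : Finset V, IsDominatingSet G Γ' →
      Γ.card < Γ'.card ∨ Γ.card = Γ'.card ∧ (isolatedIn G Γ).card ≤ (isolatedIn G Γ').card := by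
    intro Γ' h
    have := hmin Γ' (by simpa using h)
    simpa [Prod.Lex.toLex_le_toLex] using this
  refine ⟨Γ, hdom, ?_⟩
  intro u hu
  by_contra hcon
  -- every outside neighbor of `u` has another neighbor in `Γ`
  have hother : ∀ p, p ∉ Γ → G.Adj u p → ∃ v ∈ Γ, G.Adj v p ∧ v ≠ u := by
    intro p hp hup
    by_contra hno
    apply hcon
    refine ⟨p, hp, hup, fun v hv hvp => ?_⟩
    by_contra hne
    exact hno ⟨v, hv, hvp, hne⟩
  have hcard : (Γ.erase u).card + 1 = Γ.card := Finset.card_erase_add_one hu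
  -- vertices outside `Γ` remain dominated after deleting `u`
  have hdom' : ∀ p, p ∉ Γ → ∃ v ∈ Γ.erase u, G.Adj p v := by
    intro p hp
    obtain ⟨w, hw, hpw⟩ := hdom p hp
    by_cases hwu : w = u
    · subst hwu
      obtain ⟨v, hv, hvp, hne⟩ := hother p hp hpw.symm
      exact ⟨v, Finset.mem_erase.2 ⟨hne, hv⟩, hvp.symm⟩
    · exact ⟨w, Finset.mem_erase.2 ⟨hwu, hw⟩, hpw⟩
  -- `u` is isolated in `Γ`
  have huiso : ∀ y ∈ Γ, ¬ G.Adj u y := by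
    intro y hy huy
    have hd : IsDominatingSet G (Γ.erase u) := by
      intro p hp
      by_cases hpu : p = u
      · subst hpu
        exact ⟨y, Finset.mem_erase.2 ⟨huy.ne', hy⟩, huy⟩
      · exact hdom' p (fun h => hp (Finset.mem_erase.2 ⟨hpu, h⟩))
    have := hmin' _ hd
    omega
  obtain ⟨v, huv⟩ := hiso u
  have hv : v ∉ Γ := fun h => huiso v h huv
  obtain ⟨w, hw, hwv, hwu⟩ := hother v hv huv
  have hd : IsDominatingSet G (insert v (Γ.erase u)) := by
    intro p hp
    by_cases hpu : p = u
    · subst hpu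
      exact ⟨v, Finset.mem_insert_self _ _, huv⟩
    · obtain ⟨x, hx, hpx⟩ := hdom' p
        (fun h => hp (Finset.mem_insert_of_mem (Finset.mem_erase.2 ⟨hpu, h⟩)))
      exact ⟨x, Finset.mem_insert_of_mem hx, hpx⟩
  have hc : (insert v (Γ.erase u)).card = Γ.card := by
    rw [Finset.card_insert_of_notMem (fun h => hv (Finset.mem_of_mem_erase h)), hcard]
  have hss : isolatedIn G (insert v (Γ.erase u)) ⊂ isolatedIn G Γ := by
    rw [Finset.ssubset_iff_of_subset]
    · refine ⟨u, by simp [isolatedIn, hu]; exact huiso, ?_⟩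
      simp [isolatedIn, huv.ne]
    · intro x hx
      simp only [isolatedIn, Finset.mem_filter, Finset.mem_insert, Finset.mem_erase] at hx ⊢
      obtain ⟨hx1, hx2⟩ := hx
      rcases hx1 with rfl | ⟨hxu, hxΓ⟩
      · exact absurd hwv.symm (hx2 w (Or.inr ⟨hwu, hw⟩))
      · refine ⟨hxΓ, fun y hy hxy => ?_⟩
        by_cases hyu : y = u
        · subst hyu
          exact huiso x hxΓ hxy.symm
        · exact hx2 y (Or.inr ⟨hyu, hy⟩) hxy
  have h1 := Finset.card_lt_card hss
  have := hmin' _ hd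
  omega

/-- A dominating set has at least `n / (1 + Δ)` vertices. -/
theorem card_le_of_dominating [Fintype V] (G : SimpleGraph V) [DecidableRel G.Adj]
    (Γ : Finset V) (h : IsDominatingSet G Γ) :
    Fintype.card V ≤ Γ.card * (1 + G.maxDegree) := by
  classical
  have hcov : (Finset.univ : Finset V) ⊆ Γ.biUnion (fun u => insert u (G.neighborFinset u)) := by
    intro v _
    rw [Finset.mem_biUnion]
    by_cases hv : v ∈ Γ
    · exact ⟨v, hv, Finset.mem_insert_self _ _⟩
    · obtain ⟨u, hu, hvu⟩ := h v hv
      exact ⟨u, hu, Finset.mem_insert_of_mem (by simpa using hvu.symm)⟩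
  refine (Finset.card_le_card hcov).trans (Finset.card_biUnion_le_card_mul _ _ _ ?_)
  intro u _
  refine (Finset.card_insert_le _ _).trans ?_
  have := G.degree_le_maxDegree u
  rw [G.card_neighborFinset_eq_degree]
  omega

/-- For every connected graph `G` of order `n`,
`β(G) ≤ n - ⌈n / (1 + Δ(G))⌉`. -/
theorem metricDimension_le_card_sub_ceil_card_div_one_add_maxDegree [Fintype V]
    (G : SimpleGraph V) [DecidableRel G.Adj] (hG : G.Connected) :
    (metricDimension G : ℤ) ≤
      (Fintype.card V : ℤ) - ⌈(Fintype.card V : ℚ) / (1 + (G.maxDegree : ℚ))⌉ := by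
  classical
  have hpos : (0 : ℚ) < 1 + (G.maxDegree : ℚ) := by positivity
  by_cases hiso : ∀ u : V, ∃ v, G.Adj u v
  · obtain ⟨Γ, hdom, hpriv⟩ := exists_private_dominating G hiso
    have hres : IsResolvingSet G Γᶜ := by
      intro u v huv
      by_cases hu : u ∈ Γ
      · by_cases hv : v ∈ Γ
        · obtain ⟨p, hp, hup, hall⟩ := hpriv u hu
          refine ⟨p, by simpa using hp, ?_⟩
          intro heq
          rw [SimpleGraph.dist_eq_one_iff_adj.2 hup] at heq
          exact huv (hall v hv (SimpleGraph.dist_eq_one_iff_adj.1 heq.symm)).symm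
        · refine ⟨v, by simpa using hv, ?_⟩
          rw [SimpleGraph.dist_self]
          exact (hG.pos_dist_of_ne huv).ne'
      · refine ⟨u, by simpa using hu, ?_⟩
        rw [SimpleGraph.dist_self]
        exact (hG.pos_dist_of_ne huv.symm).ne
    have h1 : metricDimension G ≤ Γᶜ.card := Nat.sInf_le ⟨_, hres, rfl⟩
    have h2 : Γ.card + Γᶜ.card = Fintype.card V := Finset.card_add_card_compl Γ
    have h3 : ⌈(Fintype.card V : ℚ) / (1 + (G.maxDegree : ℚ))⌉ ≤ (Γ.card : ℤ) := by
      rw [Int.ceil_le, div_le_iff₀ hpos]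
      exact_mod_cast card_le_of_dominating G Γ hdom
    omega
  · push Not at hiso
    obtain ⟨u, hu⟩ := hiso
    have hall : ∀ v, v = u := by
      intro v
      by_contra hne
      haveI : Nontrivial V := ⟨⟨v, u, hne⟩⟩
      obtain ⟨w, hw⟩ := hG.preconnected.exists_adj_of_nontrivial u
      exact hu w hw
    have h1 : metricDimension G ≤ 0 := by
      refine Nat.sInf_le ⟨∅, ?_, rfl⟩
      intro a b hab
      exact absurd ((hall a).trans (hall b).symm) hab
    have h3 : ⌈(Fintype.card V : ℚ) / (1 + (G.maxDegree : ℚ))⌉ ≤ (Fintype.card V : ℤ) := by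
      rw [Int.ceil_le, div_le_iff₀ hpos]
      have : 0 ≤ (Fintype.card V : ℚ) * (G.maxDegree : ℚ) := by positivity
      push_cast
      linarith
    omega
end

section
/- If G is a finite simple connected graph of order n with minimum degree δ(G) ≥ 2 and girth g ≥ 7, then β(G) ≤ n − Δ(G), where Δ(G) is the maximum degree of G. -/
open SimpleGraph Finset

variable {V : Type*}

/-- If `G` is connected of order `n` with `δ(G) ≥ 2` and girth at least `7`,
then `β(G) ≤ n - Δ(G)`. -/
theorem metricDimension_le_card_sub_maxDegree_of_two_le_minDegree_of_seven_le_girth [Fintype V]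
    (G : SimpleGraph V) [DecidableRel G.Adj] (hG : G.Connected)
    (hδ : 2 ≤ G.minDegree) (hg : 7 ≤ G.egirth) :
    metricDimension G ≤ Fintype.card V - G.maxDegree := by
  classical
  have := hG.nonempty
  rw [le_egirth] at hg
  -- no triangles
  have h3 : ∀ a b c : V, G.Adj a b → G.Adj b c → G.Adj c a → False := by
    intro a b c hab hbc hca
    have hc : (Walk.cons hab (Walk.cons hbc (Walk.cons hca Walk.nil))).IsCycle := by
      rw [Walk.cons_isCycle_iff]
      simp [hab.ne', hbc.ne, hca.ne, hab.ne, hca.ne', hbc.ne']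
    have h := hg a _ hc
    simp only [Walk.length_cons, Walk.length_nil] at h
    norm_cast at h
  -- no quadrilaterals
  have h4 : ∀ a b c d : V, G.Adj a b → G.Adj b c → G.Adj c d → G.Adj d a →
      a ≠ c → b ≠ d → False := by
    intro a b c d hab hbc hcd hda hac hbd
    have hc : (Walk.cons hab (Walk.cons hbc (Walk.cons hcd (Walk.cons hda Walk.nil)))).IsCycle := by
      rw [Walk.cons_isCycle_iff]
      simp [hab.ne', hbc.ne, hcd.ne, hda.ne, hab.ne, hbc.ne', hda.ne', hac, hac.symm, hbd,
        hbd.symm]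
    have h := hg a _ hc
    simp only [Walk.length_cons, Walk.length_nil] at h
    norm_cast at h
  obtain ⟨v, hv⟩ := G.exists_maximal_degree_vertex
  refine Nat.sInf_le ⟨(G.neighborFinset v)ᶜ, ?_, ?_⟩
  · intro x y hxy
    by_cases hx : G.Adj v x
    · by_cases hy : G.Adj v y
      · have hdeg : 1 < (G.neighborFinset x).card := by
          rw [card_neighborFinset_eq_degree]
          exact lt_of_lt_of_le (by norm_num) (hδ.trans (G.minDegree_le_degree x))
        obtain ⟨z, hz, hzv⟩ := Finset.exists_mem_ne hdeg v
        rw [mem_neighborFinset] at hz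
        refine ⟨z, ?_, ?_⟩
        · simp only [mem_compl, mem_neighborFinset]
          intro hvz
          exact h3 v x z hx hz hvz.symm
        · rw [dist_eq_one_iff_adj.mpr hz]
          intro h
          have hyz : G.Adj y z := dist_eq_one_iff_adj.mp h.symm
          exact h4 v x z y hx hz hyz.symm hy.symm hzv.symm hxy
      · refine ⟨y, by simpa using hy, ?_⟩
        rw [dist_self]
        exact (hG.pos_dist_of_ne hxy).ne'
    · refine ⟨x, by simpa using hx, ?_⟩
      rw [dist_self]
      exact (hG.pos_dist_of_ne hxy.symm).ne
  · rw [card_compl, card_neighborFinset_eq_degree, hv]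
end
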